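/- arXiv:1507.02051 — 3 statements merged into one kernel-verified Lean document; each statement's English description precedes it below -/
import Mathlib

section
/- If the solution set of the primal problem (P), i.e. {(y,z) ∈ dom f × dom g : A*y + B*z = c and f(y)+g(z) ≤ f(y'')+g(z'') for all (y'',z'') with A*y''+B*z''=c}, is nonempty and bounded, then for every (x',y',z') ∈ X × dom f × dom g both the y-subproblem and the z-subproblem have nonempty and bounded solution sets. -/
open scoped RealInnerProductSpace
open Filter Bornology

noncomputable section

variable {X Y Z : Type*}
variable [NormedAddCommGroup X] [InnerProductSpace ℝ X] [FiniteDimensional ℝ X]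
variable [NormedAddCommGroup Y] [InnerProductSpace ℝ Y] [FiniteDimensional ℝ Y]
variable [NormedAddCommGroup Z] [InnerProductSpace ℝ Z] [FiniteDimensional ℝ Z]

/-- `f : E → ℝ ∪ {+∞}` is proper, convex and lower semicontinuous. -/
def ProperConvexLsc {E : Type*} [NormedAddCommGroup E] [InnerProductSpace ℝ E]
    (f : E → EReal) : Prop :=
  (∃ u, f u ≠ ⊤) ∧ (∀ u, f u ≠ ⊥) ∧
    (∀ u v : E, ∀ a b : ℝ, 0 ≤ a → 0 ≤ b → a + b = 1 →
      f (a • u + b • v) ≤ (a : EReal) * f u + (b : EReal) * f v) ∧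
    LowerSemicontinuous f

/-- `frec` is the recession function of `f`:  for any `u₀` in the effective domain of `f`,
`frec u = lim_{ρ → +∞} (f (u₀ + ρ u) - f u₀) / ρ`. -/
def IsRecessionFn {E : Type*} [NormedAddCommGroup E] [InnerProductSpace ℝ E]
    (f : E → EReal) (frec : E → EReal) : Prop :=
  ∀ u₀ : E, f u₀ ≠ ⊤ → ∀ u : E,
    Tendsto (fun ρ : ℝ => (f (u₀ + ρ • u) - f u₀) * ((ρ⁻¹ : ℝ) : EReal))
      atTop (nhds (frec u))

/-- The augmented Lagrangian `L_σ(y, z; x)` of the problem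
`min f(y) + g(z)  s.t.  A* y + B* z = c`. -/
def augL (f : Y → EReal) (g : Z → EReal) (A : X →ₗ[ℝ] Y) (B : X →ₗ[ℝ] Z)
    (c : X) (σ : ℝ) (y : Y) (z : Z) (x : X) : EReal :=
  f y + g z + ((⟪x, (LinearMap.adjoint A) y + (LinearMap.adjoint B) z - c⟫ : ℝ) : EReal)
    + ((σ / 2 * ‖(LinearMap.adjoint A) y + (LinearMap.adjoint B) z - c‖ ^ 2 : ℝ) : EReal)

/-- Objective of the `y`-subproblem:  `F(w) = L_σ(w, z'; x') + (1/2) ‖w - y'‖_S²`. -/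
def ysub (f : Y → EReal) (g : Z → EReal) (A : X →ₗ[ℝ] Y) (B : X →ₗ[ℝ] Z)
    (c : X) (σ : ℝ) (S : Y →ₗ[ℝ] Y) (x' : X) (y' : Y) (z' : Z) (w : Y) : EReal :=
  augL f g A B c σ w z' x' + ((⟪w - y', S (w - y')⟫ / 2 : ℝ) : EReal)

/-- Objective of the `z`-subproblem:  `G(w) = L_σ(y', w; x') + (1/2) ‖w - z'‖_T²`. -/
def zsub (f : Y → EReal) (g : Z → EReal) (A : X →ₗ[ℝ] Y) (B : X →ₗ[ℝ] Z)
    (c : X) (σ : ℝ) (T : Z →ₗ[ℝ] Z) (x' : X) (y' : Y) (z' : Z) (w : Z) : EReal :=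
  augL f g A B c σ y' w x' + ((⟪w - z', T (w - z')⟫ / 2 : ℝ) : EReal)

section Recession

variable {E V : Type*}
variable [NormedAddCommGroup E] [InnerProductSpace ℝ E]
variable [NormedAddCommGroup V] [InnerProductSpace ℝ V]

/-- If a sublevel set of a proper convex lower semicontinuous function is unbounded, then the
function is nonincreasing along some nonzero direction, from every starting point. -/
theorem ProperConvexLsc.exists_recession_direction [FiniteDimensional ℝ E]
    {φ : E → EReal} (hφ : ProperConvexLsc φ)
    {m : ℝ} (hC : ¬ IsBounded {w | φ w ≤ m}) :
    ∃ d : E, d ≠ 0 ∧ ∀ u : E, ∀ t : ℝ, 0 ≤ t → φ (u + t • d) ≤ φ u := by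
  obtain ⟨-, hbot, hconv, hlsc⟩ := hφ
  have hex : ∀ n : ℕ, ∃ w, φ w ≤ m ∧ (n : ℝ) < ‖w‖ := by
    intro n
    by_contra! h
    exact hC (isBounded_iff_forall_norm_le.2 ⟨n, fun w hw => h w hw⟩)
  choose w hwm hwn using hex
  have hpos : ∀ n, 0 < ‖w n‖ := fun n => (Nat.cast_nonneg n).trans_lt (hwn n)
  have hsphere : ∀ n, ‖w n‖⁻¹ • w n ∈ Metric.sphere (0 : E) 1 := by
    intro n
    simp [norm_smul, (hpos n).ne']
  obtain ⟨d, hd, k, hk, hlim⟩ := (isCompact_sphere (0 : E) 1).tendsto_subseq hsphere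
  refine ⟨d, ?_, fun u t ht => ?_⟩
  · rintro rfl
    simp at hd
  by_cases hu : φ u = ⊤
  · simp [hu]
  obtain ⟨p, hp⟩ : ∃ p : ℝ, φ u = p := ⟨_, (EReal.coe_toReal hu (hbot u)).symm⟩
  have hinf : Tendsto (fun n => ‖w (k n)‖) atTop atTop :=
    (tendsto_atTop_mono (fun n => (hwn n).le) tendsto_natCast_atTop_atTop).comp hk.tendsto_atTop
  have hs : Tendsto (fun n => t * ‖w (k n)‖⁻¹) atTop (nhds 0) := by
    simpa using hinf.inv_tendsto_atTop.const_mul t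
  have hpt : Tendsto (fun n => (1 - t * ‖w (k n)‖⁻¹) • u + (t * ‖w (k n)‖⁻¹) • w (k n))
      atTop (nhds (u + t • d)) := by
    have h1 : Tendsto (fun n => (1 - t * ‖w (k n)‖⁻¹) • u) atTop (nhds ((1 - 0 : ℝ) • u)) :=
      (hs.const_sub 1).smul_const u
    have h2 := h1.add (hlim.const_smul t)
    simpa [mul_smul] using h2
  have hval : Tendsto (fun n => (1 - t * ‖w (k n)‖⁻¹) * p + (t * ‖w (k n)‖⁻¹) * m)
      atTop (nhds p) := by
    simpa using ((hs.const_sub 1).mul_const p).add (hs.mul_const m)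
  by_contra! hlt
  rw [hp] at hlt
  obtain ⟨r, hpr, hr⟩ := EReal.lt_iff_exists_real_btwn.1 hlt
  have hpr' : p < r := EReal.coe_lt_coe_iff.1 hpr
  obtain ⟨n, hn1, hn2, hn3⟩ := ((hpt.eventually (hlsc _ _ hr)).and
    ((hval.eventually_lt_const hpr').and (hs.eventually_lt_const one_pos))).exists
  have hs0 : 0 ≤ t * ‖w (k n)‖⁻¹ := by positivity
  have hle := hconv u (w (k n)) _ _ (sub_nonneg.2 hn3.le) hs0 (by ring)
  have hmul : ((t * ‖w (k n)‖⁻¹ : ℝ) : EReal) * φ (w (k n)) ≤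
      ((t * ‖w (k n)‖⁻¹ : ℝ) : EReal) * (m : EReal) :=
    mul_le_mul_of_nonneg_left (hwm _) (EReal.coe_nonneg.2 hs0)
  have hfin := hle.trans (add_le_add_right hmul _)
  rw [hp, ← EReal.coe_mul, ← EReal.coe_mul, ← EReal.coe_add] at hfin
  have hrlt := hn1.trans_le hfin
  rw [EReal.coe_lt_coe_iff] at hrlt
  linarith

/-- A proper convex lower semicontinuous function which decreases along no nonzero direction has
a nonempty and bounded set of minimizers. -/
theorem ProperConvexLsc.nonempty_isBounded_minimizers [FiniteDimensional ℝ E]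
    {φ : E → EReal} (hφ : ProperConvexLsc φ)
    (hdir : ∀ d : E, (∀ u : E, ∀ t : ℝ, 0 ≤ t → φ (u + t • d) ≤ φ u) → d = 0) :
    Set.Nonempty {v : E | (∀ w, φ v ≤ φ w) ∧ φ v < ⊤} ∧
      IsBounded {v : E | (∀ w, φ v ≤ φ w) ∧ φ v < ⊤} := by
  obtain ⟨u, hu⟩ := hφ.1
  obtain ⟨m, hm⟩ : ∃ m : ℝ, φ u = m := ⟨_, (EReal.coe_toReal hu (hφ.2.1 u)).symm⟩
  have hC : IsBounded {w | φ w ≤ m} := by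
    by_contra h
    obtain ⟨d, hd, hrec⟩ := hφ.exists_recession_direction h
    exact hd (hdir d hrec)
  have hcomp : IsCompact {w | φ w ≤ m} :=
    Metric.isCompact_of_isClosed_isBounded (hφ.2.2.2.isClosed_preimage (m : EReal)) hC
  obtain ⟨v, hv, hmin⟩ := LowerSemicontinuousOn.exists_isMinOn ⟨u, hm.le⟩ hcomp
    (hφ.2.2.2.lowerSemicontinuousOn _)
  refine ⟨⟨v, fun w => ?_, hv.trans_lt (EReal.coe_lt_top m)⟩,
    hC.subset fun w hw => (hw.1 u).trans hm.le⟩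
  rcases le_total (φ w) m with h | h
  · exact hmin h
  · exact le_trans hv h

/-- Adding a continuous convex real-valued function keeps a function proper, convex and lower
semicontinuous. -/
theorem ProperConvexLsc.add_coe {f : E → EReal} (hf : ProperConvexLsc f) {q : E → ℝ}
    (hq : ConvexOn ℝ Set.univ q) (hqc : Continuous q) :
    ProperConvexLsc fun w => f w + (q w : EReal) := by
  obtain ⟨⟨u, hu⟩, hbot, hconv, hlsc⟩ := hf
  refine ⟨⟨u, ?_⟩, fun w => ?_, fun v w a b ha hb hab => ?_, ?_⟩
  · exact EReal.add_ne_top hu (EReal.coe_ne_top _)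
  · simpa [EReal.add_eq_bot_iff] using hbot w
  · have h1 := hconv v w a b ha hb hab
    have h2 : q (a • v + b • w) ≤ a * q v + b * q w :=
      hq.2 (Set.mem_univ v) (Set.mem_univ w) ha hb hab
    have h3 := add_le_add h1 (EReal.coe_le_coe_iff.2 h2)
    refine h3.trans_eq ?_
    rw [EReal.left_distrib_of_nonneg_of_ne_top (EReal.coe_nonneg.2 ha) (EReal.coe_ne_top a),
      EReal.left_distrib_of_nonneg_of_ne_top (EReal.coe_nonneg.2 hb) (EReal.coe_ne_top b),
      EReal.coe_add, EReal.coe_mul, EReal.coe_mul, add_add_add_comm]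
  · exact hlsc.add' (continuous_coe_real_ereal.comp hqc).lowerSemicontinuous fun w =>
      EReal.continuousAt_add (Or.inr (EReal.coe_ne_bot _)) (Or.inl (hbot w))

/-- The smooth part of a proximal augmented Lagrangian subproblem. -/
def smoothPart (L : E →ₗ[ℝ] V) (r x' : V) (σ : ℝ) (S : E →ₗ[ℝ] E) (e : E) (κ : ℝ) (w : E) : ℝ :=
  κ + ⟪x', L w + r⟫ + σ / 2 * ‖L w + r‖ ^ 2 + ⟪w - e, S (w - e)⟫ / 2

/-- The smooth part is quadratic along lines. -/
theorem smoothPart_add_smul (L : E →ₗ[ℝ] V) (r x' : V) (σ : ℝ) {S : E →ₗ[ℝ] E}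
    (hS : S.IsSymmetric) (e : E) (κ : ℝ) (u d : E) (t : ℝ) :
    smoothPart L r x' σ S e κ (u + t • d) = smoothPart L r x' σ S e κ u
      + t * (⟪x', L d⟫ + σ * ⟪L u + r, L d⟫ + ⟪u - e, S d⟫)
      + t ^ 2 * (σ / 2 * ‖L d‖ ^ 2 + ⟪d, S d⟫ / 2) := by
  have h1 : L (u + t • d) + r = (L u + r) + t • L d := by
    rw [map_add, map_smul]
    abel
  have h2 : u + t • d - e = (u - e) + t • d := by abel
  have h3 : ⟪d, S (u - e)⟫ = ⟪u - e, S d⟫ := by rw [← hS d (u - e), real_inner_comm]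
  unfold smoothPart
  rw [h1, h2, norm_add_sq_real]
  simp only [map_add S, map_smul, inner_add_left, inner_add_right, real_inner_smul_left,
    real_inner_smul_right, norm_smul, mul_pow, Real.norm_eq_abs, sq_abs] at h3 ⊢
  rw [h3]
  ring

theorem continuous_smoothPart [FiniteDimensional ℝ E]
    (L : E →ₗ[ℝ] V) (r x' : V) (σ : ℝ) (S : E →ₗ[ℝ] E) (e : E)
    (κ : ℝ) : Continuous (smoothPart L r x' σ S e κ) := by
  have hL : Continuous L := L.continuous_of_finiteDimensional
  have hS : Continuous S := S.continuous_of_finiteDimensional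
  unfold smoothPart
  fun_prop

theorem convexOn_smoothPart (L : E →ₗ[ℝ] V) (r x' : V) {σ : ℝ} (hσ : 0 ≤ σ) {S : E →ₗ[ℝ] E}
    (hS : S.IsSymmetric) (hpsd : ∀ w, 0 ≤ ⟪w, S w⟫) (e : E) (κ : ℝ) :
    ConvexOn ℝ Set.univ (smoothPart L r x' σ S e κ) := by
  refine ⟨convex_univ, fun u _ v _ a b ha hb hab => ?_⟩
  obtain rfl : a = 1 - b := by linarith
  have h1 : (1 - b) • u + b • v = u + b • (v - u) := by module
  have h2 : v = u + (1 : ℝ) • (v - u) := by module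
  have hα : 0 ≤ σ / 2 * ‖L (v - u)‖ ^ 2 + ⟪v - u, S (v - u)⟫ / 2 := by
    have := hpsd (v - u)
    positivity
  have e1 := smoothPart_add_smul L r x' σ hS e κ u (v - u) b
  have e2 := smoothPart_add_smul L r x' σ hS e κ u (v - u) 1
  rw [← h1] at e1
  rw [← h2] at e2
  rw [e1, e2]
  simp only [smul_eq_mul]
  nlinarith [mul_nonneg (mul_nonneg ha hb) hα]

/-- A null vector of a positive semidefinite form is orthogonal to everything for that form. -/
theorem inner_apply_eq_zero_of_psd {S : E →ₗ[ℝ] E} (hS : S.IsSymmetric)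
    (hpsd : ∀ w, 0 ≤ ⟪w, S w⟫) {d : E} (hd : ⟪d, S d⟫ = 0) (u : E) : ⟪u, S d⟫ = 0 := by
  have h3 : ⟪d, S u⟫ = ⟪u, S d⟫ := by rw [← hS d u, real_inner_comm]
  have key : ∀ t : ℝ, 0 ≤ ⟪u, S u⟫ + 2 * t * ⟪u, S d⟫ := by
    intro t
    have h := hpsd (u + t • d)
    simp only [map_add, map_smul, inner_add_left, inner_add_right, real_inner_smul_left,
      real_inner_smul_right, h3, hd] at h
    linarith
  by_contra hne
  have h := key (-(⟪u, S u⟫ + 1) / (2 * ⟪u, S d⟫))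
  have h4 : 2 * (-(⟪u, S u⟫ + 1) / (2 * ⟪u, S d⟫)) * ⟪u, S d⟫ = -(⟪u, S u⟫ + 1) := by
    field_simp
  linarith

/-- If no nonzero direction in the kernel of `L` is a direction of recession of `f`, then adding
the smooth part to `f` gives a function with a nonempty and bounded set of minimizers. -/
theorem ProperConvexLsc.minimizers_add_smoothPart [FiniteDimensional ℝ E]
    {f : E → EReal} (hf : ProperConvexLsc f)
    (L : E →ₗ[ℝ] V) (r x' : V) {σ : ℝ} (hσ : 0 < σ) {S : E →ₗ[ℝ] E}
    (hS : S.IsSymmetric) (hpsd : ∀ w, 0 ≤ ⟪w, S w⟫) (e : E) (κ : ℝ)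
    (hdir : ∀ d : E, L d = 0 → (∀ u : E, ∀ t : ℝ, 0 ≤ t → f (u + t • d) ≤ f u) → d = 0) :
    let φ : E → EReal := fun w => f w + (smoothPart L r x' σ S e κ w : EReal)
    Set.Nonempty {v : E | (∀ w, φ v ≤ φ w) ∧ φ v < ⊤} ∧
      IsBounded {v : E | (∀ w, φ v ≤ φ w) ∧ φ v < ⊤} := by
  intro φ
  have hφ : ProperConvexLsc φ := hf.add_coe (convexOn_smoothPart L r x' hσ.le hS hpsd e κ)
    (continuous_smoothPart L r x' σ S e κ)
  refine hφ.nonempty_isBounded_minimizers fun d hd => ?_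
  have hexp := smoothPart_add_smul L r x' σ hS e κ
  set q := smoothPart L r x' σ S e κ
  have hreal : ∀ u : E, ∀ p : ℝ, f u = p → ∀ t : ℝ, 0 ≤ t →
      ∃ s : ℝ, f (u + t • d) = s ∧ s + q (u + t • d) ≤ p + q u := by
    intro u p hp t ht
    have h : f (u + t • d) + (q (u + t • d) : EReal) ≤ f u + (q u : EReal) := hd u t ht
    have htop : f (u + t • d) ≠ ⊤ := by
      intro h0
      rw [h0, hp, EReal.top_add_coe, ← EReal.coe_add] at h
      exact (EReal.coe_lt_top _).not_ge h
    refine ⟨_, (EReal.coe_toReal htop (hf.2.1 _)).symm, ?_⟩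
    rw [← EReal.coe_toReal htop (hf.2.1 _), hp] at h
    exact_mod_cast h
  have hquad : σ / 2 * ‖L d‖ ^ 2 + ⟪d, S d⟫ / 2 ≤ 0 := by
    obtain ⟨u, hu⟩ := hf.1
    obtain ⟨p, hp⟩ : ∃ p : ℝ, f u = p := ⟨_, (EReal.coe_toReal hu (hf.2.1 u)).symm⟩
    obtain ⟨p₁, hp₁, -⟩ := hreal u p hp 1 zero_le_one
    set β := ⟪x', L d⟫ + σ * ⟪L u + r, L d⟫ + ⟪u - e, S d⟫ with hβ
    set α := σ / 2 * ‖L d‖ ^ 2 + ⟪d, S d⟫ / 2 with hα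
    have key : ∀ t : ℝ, 1 ≤ t → p₁ - p + β + t * α ≤ 0 := by
      intro t ht
      have ht0 : 0 < t := one_pos.trans_le ht
      obtain ⟨s, hs, hle⟩ := hreal u p hp t ht0.le
      have hc := hf.2.2.1 u (u + t • d) (1 - t⁻¹) t⁻¹
        (sub_nonneg.2 (inv_le_one_of_one_le₀ ht)) (by positivity) (by ring)
      have hpt : (1 - t⁻¹) • u + t⁻¹ • (u + t • d) = u + (1 : ℝ) • d := by
        rw [smul_add, smul_smul, inv_mul_cancel₀ ht0.ne']
        module
      rw [hpt, hp₁, hp, hs] at hc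
      have hc' : p₁ ≤ (1 - t⁻¹) * p + t⁻¹ * s := by exact_mod_cast hc
      have hc2 : t * p₁ ≤ t * ((1 - t⁻¹) * p + t⁻¹ * s) := mul_le_mul_of_nonneg_left hc' ht0.le
      have hc3 : t * ((1 - t⁻¹) * p + t⁻¹ * s) = (t - 1) * p + s := by
        field_simp
      rw [hexp u d t, ← hβ, ← hα] at hle
      have : t * (p₁ - p + β + t * α) ≤ 0 := by nlinarith
      exact nonpos_of_mul_nonpos_right this ht0
    by_contra! hpos
    have h := key (max 1 ((|p₁ - p + β| + 1) / α)) (le_max_left _ _)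
    have h1 : |p₁ - p + β| + 1 ≤ max 1 ((|p₁ - p + β| + 1) / α) * α :=
      (div_le_iff₀ hpos).1 (le_max_right _ _)
    linarith [neg_abs_le (p₁ - p + β)]
  have hSd : ⟪d, S d⟫ = 0 := by
    have : 0 ≤ σ / 2 * ‖L d‖ ^ 2 := by positivity
    linarith [hpsd d]
  have hLd : L d = 0 := by
    rw [hSd] at hquad
    have h0 : ‖L d‖ ^ 2 ≤ 0 := by
      by_contra! h
      have : 0 < σ / 2 * ‖L d‖ ^ 2 := by positivity
      linarith
    simpa using le_antisymm h0 (sq_nonneg _)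
  refine hdir d hLd fun u t ht => ?_
  by_cases hu : f u = ⊤
  · simp [hu]
  have hp := (EReal.coe_toReal hu (hf.2.1 u)).symm
  obtain ⟨s, hs, hle⟩ := hreal u _ hp t ht
  rw [hexp u d t, hSd, hLd, inner_apply_eq_zero_of_psd hS hpsd hSd] at hle
  rw [hs, hp, EReal.coe_le_coe_iff]
  simpa using hle

/-- A vector whose forward multiples, translated by `u`, stay in a bounded set is zero. -/
theorem eq_zero_of_isBounded_ray {F : Type*} [NormedAddCommGroup F] [NormedSpace ℝ F]
    {s : Set F} (hs : IsBounded s) {u d : F} (h : ∀ t : ℝ, 0 ≤ t → u + t • d ∈ s) : d = 0 := by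
  obtain ⟨M, hM⟩ := isBounded_iff_forall_norm_le.1 hs
  by_contra hd
  have hpos : 0 < ‖d‖ := norm_pos_iff.2 hd
  have hM0 : 0 ≤ M := (norm_nonneg _).trans (hM _ (h 0 le_rfl))
  have ht : 0 ≤ (M + ‖u‖ + 1) / ‖d‖ := by positivity
  have h1 := hM _ (h _ ht)
  have h2 : ‖((M + ‖u‖ + 1) / ‖d‖) • d‖ = M + ‖u‖ + 1 := by
    rw [norm_smul, Real.norm_of_nonneg ht, div_mul_cancel₀ _ hpos.ne']
  have h3 := norm_sub_le (u + ((M + ‖u‖ + 1) / ‖d‖) • d) u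
  rw [add_sub_cancel_left, h2] at h3
  linarith

end Recession

/-- **Corollary 1.**  If the solution set of the primal problem is nonempty and bounded,
then for every `(x', y', z') ∈ X × dom f × dom g` both the `y`-subproblem and the
`z`-subproblem have nonempty and bounded solution sets. -/
theorem stmt_5
    (f : Y → EReal) (g : Z → EReal)
    (hf : ProperConvexLsc f) (hg : ProperConvexLsc g)
    (A : X →ₗ[ℝ] Y) (B : X →ₗ[ℝ] Z) (c : X)
    (σ : ℝ) (hσ : 0 < σ)
    (S : Y →ₗ[ℝ] Y) (hSsym : S.IsSymmetric) (hSpsd : ∀ w : Y, 0 ≤ ⟪w, S w⟫)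
    (T : Z →ₗ[ℝ] Z) (hTsym : T.IsSymmetric) (hTpsd : ∀ w : Z, 0 ≤ ⟪w, T w⟫)
    (hP : Set.Nonempty {p : Y × Z | f p.1 ≠ ⊤ ∧ g p.2 ≠ ⊤ ∧
        (LinearMap.adjoint A) p.1 + (LinearMap.adjoint B) p.2 = c ∧
        ∀ q : Y × Z, (LinearMap.adjoint A) q.1 + (LinearMap.adjoint B) q.2 = c →
          f p.1 + g p.2 ≤ f q.1 + g q.2})
    (hPb : IsBounded {p : Y × Z | f p.1 ≠ ⊤ ∧ g p.2 ≠ ⊤ ∧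
        (LinearMap.adjoint A) p.1 + (LinearMap.adjoint B) p.2 = c ∧
        ∀ q : Y × Z, (LinearMap.adjoint A) q.1 + (LinearMap.adjoint B) q.2 = c →
          f p.1 + g p.2 ≤ f q.1 + g q.2}) :
    ∀ (x' : X) (y' : Y) (z' : Z), f y' ≠ ⊤ → g z' ≠ ⊤ →
      (Set.Nonempty {yhat : Y |
          (∀ w : Y, ysub f g A B c σ S x' y' z' yhat ≤ ysub f g A B c σ S x' y' z' w) ∧
          ysub f g A B c σ S x' y' z' yhat < ⊤} ∧
        IsBounded {yhat : Y |
          (∀ w : Y, ysub f g A B c σ S x' y' z' yhat ≤ ysub f g A B c σ S x' y' z' w) ∧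
          ysub f g A B c σ S x' y' z' yhat < ⊤}) ∧
      (Set.Nonempty {zhat : Z |
          (∀ w : Z, zsub f g A B c σ T x' y' z' zhat ≤ zsub f g A B c σ T x' y' z' w) ∧
          zsub f g A B c σ T x' y' z' zhat < ⊤} ∧
        IsBounded {zhat : Z |
          (∀ w : Z, zsub f g A B c σ T x' y' z' zhat ≤ zsub f g A B c σ T x' y' z' w) ∧
          zsub f g A B c σ T x' y' z' zhat < ⊤}) := by
  obtain ⟨⟨y, z⟩, hy, hz, hfeas, hopt⟩ := hP
  have hdirY : ∀ d : Y, (LinearMap.adjoint A) d = 0 →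
      (∀ u : Y, ∀ t : ℝ, 0 ≤ t → f (u + t • d) ≤ f u) → d = 0 := by
    intro d hd hrec
    have h := eq_zero_of_isBounded_ray hPb (u := (y, z)) (d := (d, 0)) fun t ht => by
      have hle : f (y + t • d) ≤ f y := hrec y t ht
      refine ⟨?_, by simpa using hz, by simpa [hd] using hfeas, fun p hp => ?_⟩
      · exact (hle.trans_lt (lt_top_iff_ne_top.2 hy)).ne
      · exact le_trans (by simpa using add_le_add_left hle (g z)) (hopt p hp)
    exact congrArg Prod.fst h
  have hdirZ : ∀ d : Z, (LinearMap.adjoint B) d = 0 →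
      (∀ u : Z, ∀ t : ℝ, 0 ≤ t → g (u + t • d) ≤ g u) → d = 0 := by
    intro d hd hrec
    have h := eq_zero_of_isBounded_ray hPb (u := (y, z)) (d := (0, d)) fun t ht => by
      have hle : g (z + t • d) ≤ g z := hrec z t ht
      refine ⟨by simpa using hy, ?_, by simpa [hd] using hfeas, fun p hp => ?_⟩
      · exact (hle.trans_lt (lt_top_iff_ne_top.2 hz)).ne
      · exact le_trans (by simpa using add_le_add_right hle (f y)) (hopt p hp)
    exact congrArg Prod.snd h
  intro x' y' z' hy' hz'
  constructor
  · have hφ : ysub f g A B c σ S x' y' z' = fun w => f w + (smoothPart (LinearMap.adjoint A)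
        ((LinearMap.adjoint B) z' - c) x' σ S y' (g z').toReal w : EReal) := by
      funext w
      simp only [ysub, augL, smoothPart, add_sub_assoc, EReal.coe_add,
        EReal.coe_toReal hz' (hg.2.1 z'), add_assoc]
    rw [hφ]
    exact hf.minimizers_add_smoothPart _ _ _ hσ hSsym hSpsd _ _ hdirY
  · have hφ : zsub f g A B c σ T x' y' z' = fun w => g w + (smoothPart (LinearMap.adjoint B)
        ((LinearMap.adjoint A) y' - c) x' σ T z' (f y').toReal w : EReal) := by
      funext w
      have hr : (LinearMap.adjoint A) y' + (LinearMap.adjoint B) w - c =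
          (LinearMap.adjoint B) w + ((LinearMap.adjoint A) y' - c) := by abel
      simp only [zsub, augL, smoothPart, hr, add_comm (f y') (g w), EReal.coe_add,
        EReal.coe_toReal hy' (hf.2.1 y'), add_assoc]
    rw [hφ]
    exact hg.minimizers_add_smoothPart _ _ _ hσ hTsym hTpsd _ _ hdirZ
end
end

section
/- Assume the KKT system has a solution, let {(x^k,y^k,z^k)}_{k≥0} be an infinite sequence generated by the sPADMM, and assume Condition (C) holds. Then the real sequences {f(y^k)} and {g(z^k)} are bounded. If, in addition, f0⁺(y) > 0 for every nonzero y with A*y = 0 and S y = 0, and g0⁺(z) > 0 for every nonzero z with B*z = 0 and T z = 0, then the sequences {y^k} and {z^k} are bounded. -/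
open scoped RealInnerProductSpace
open Filter Bornology

noncomputable section

variable {X Y Z : Type*}
variable [NormedAddCommGroup X] [InnerProductSpace ℝ X] [FiniteDimensional ℝ X]
variable [NormedAddCommGroup Y] [InnerProductSpace ℝ Y] [FiniteDimensional ℝ Y]
variable [NormedAddCommGroup Z] [InnerProductSpace ℝ Z] [FiniteDimensional ℝ Z]

/-- The subdifferential `∂f(u)` of a function `f : E → ℝ ∪ {+∞}`. -/
def subdiff {E : Type*} [NormedAddCommGroup E] [InnerProductSpace ℝ E]
    (f : E → EReal) (u : E) : Set E :=
  {v | ∀ w : E, f u + ((⟪v, w - u⟫ : ℝ) : EReal) ≤ f w}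

/-- `(x, y, z) : ℕ → X × Y × Z` is a sequence generated by the sPADMM scheme with
penalty parameter `σ`, step-length `τ` and proximal terms given by `S` and `T`,
started from an initial point `(x⁰, y⁰, z⁰) ∈ X × dom f × dom g`. -/
def IsSPADMM (f : Y → EReal) (g : Z → EReal) (A : X →ₗ[ℝ] Y) (B : X →ₗ[ℝ] Z)
    (c : X) (σ τ : ℝ) (S : Y →ₗ[ℝ] Y) (T : Z →ₗ[ℝ] Z)
    (x : ℕ → X) (y : ℕ → Y) (z : ℕ → Z) : Prop :=
  f (y 0) ≠ ⊤ ∧ g (z 0) ≠ ⊤ ∧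
    (∀ k : ℕ, ∀ w : Y,
      ysub f g A B c σ S (x k) (y k) (z k) (y (k + 1))
        ≤ ysub f g A B c σ S (x k) (y k) (z k) w) ∧
    (∀ k : ℕ, ∀ w : Z,
      zsub f g A B c σ T (x k) (y (k + 1)) (z k) (z (k + 1))
        ≤ zsub f g A B c σ T (x k) (y (k + 1)) (z k) w) ∧
    (∀ k : ℕ, x (k + 1) = x k + (τ * σ) •
      ((LinearMap.adjoint A) (y (k + 1)) + (LinearMap.adjoint B) (z (k + 1)) - c))

/-- `(x̄, ȳ, z̄)` solves the KKT system:
`-A x̄ ∈ ∂f(ȳ)`, `-B x̄ ∈ ∂g(z̄)` and `A* ȳ + B* z̄ = c`. -/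
def IsKKT (f : Y → EReal) (g : Z → EReal) (A : X →ₗ[ℝ] Y) (B : X →ₗ[ℝ] Z)
    (c : X) (xb : X) (yb : Y) (zb : Z) : Prop :=
  -(A xb) ∈ subdiff f yb ∧ -(B xb) ∈ subdiff g zb ∧
    (LinearMap.adjoint A) yb + (LinearMap.adjoint B) zb = c

/-- Condition (C): either `0 < τ < (1+√5)/2`, or `τ ≥ (1+√5)/2` and
`Σ_k ‖x^{k+1} - x^k‖² < ∞`. -/
def CondC {X : Type*} [NormedAddCommGroup X] (τ : ℝ) (x : ℕ → X) : Prop :=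
  (0 < τ ∧ τ < (1 + Real.sqrt 5) / 2) ∨
    ((1 + Real.sqrt 5) / 2 ≤ τ ∧ Summable fun k : ℕ => ‖x (k + 1) - x k‖ ^ 2)

/-- `Sf` satisfies `⟨v - v', u - u'⟩ ≥ ‖u - u'‖²_{Sf}` for all `v ∈ ∂f(u)`, `v' ∈ ∂f(u')`. -/
def SubMono {E : Type*} [NormedAddCommGroup E] [InnerProductSpace ℝ E]
    (f : E → EReal) (Sf : E →ₗ[ℝ] E) : Prop :=
  ∀ u u' v v' : E, v ∈ subdiff f u → v' ∈ subdiff f u' →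
    ⟪u - u', Sf (u - u')⟫ ≤ ⟪v - v', u - u'⟫

section Convex

variable {E : Type*} [NormedAddCommGroup E] [InnerProductSpace ℝ E]

lemma ProperConvexLsc.coe_toReal {f : E → EReal} (hf : ProperConvexLsc f) {u : E}
    (hu : f u ≠ ⊤) : ((f u).toReal : EReal) = f u :=
  EReal.coe_toReal hu (hf.2.1 u)

/-- Convexity in terms of real values on the effective domain. -/
lemma ProperConvexLsc.le_combo {f : E → EReal} (hf : ProperConvexLsc f) {u v : E}
    (hu : f u ≠ ⊤) (hv : f v ≠ ⊤) {t : ℝ} (h0 : 0 ≤ t) (h1 : t ≤ 1) :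
    f (u + t • (v - u)) ≤ (((1 - t) * (f u).toReal + t * (f v).toReal : ℝ) : EReal) := by
  have h := hf.2.2.1 u v (1 - t) t (by linarith) h0 (by ring)
  rw [← hf.coe_toReal hu, ← hf.coe_toReal hv] at h
  have e : u + t • (v - u) = (1 - t) • u + t • v := by module
  rw [e]
  exact_mod_cast h

lemma subdiff_ne_top {f : E → EReal} (hf : ProperConvexLsc f) {u v : E}
    (h : v ∈ subdiff f u) : f u ≠ ⊤ := by
  obtain ⟨w, hw⟩ := hf.1
  intro hu
  have := h w
  rw [hu, EReal.top_add_coe] at this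
  exact hw (top_le_iff.mp this)

lemma subdiff_toReal {f : E → EReal} (hf : ProperConvexLsc f) {u v w : E}
    (h : v ∈ subdiff f u) (hw : f w ≠ ⊤) :
    (f u).toReal + ⟪v, w - u⟫ ≤ (f w).toReal := by
  have := h w
  rw [← hf.coe_toReal hw, ← hf.coe_toReal (subdiff_ne_top hf h)] at this
  exact_mod_cast this

/-- First-order optimality condition for a proximal augmented Lagrangian subproblem. -/
lemma prox_optimality {X : Type*} [NormedAddCommGroup X] [InnerProductSpace ℝ X]
    [FiniteDimensional ℝ E] {f : E → EReal} (hf : ProperConvexLsc f)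
    (P : E →ₗ[ℝ] X) (S : E →ₗ[ℝ] E) (hS : S.IsSymmetric) (σ : ℝ) (x p : X) {u u' : E}
    (hu : f u ≠ ⊤)
    (hmin : ∀ w, f u + ((⟪x, P u + p⟫ + σ / 2 * ‖P u + p‖ ^ 2
        + ⟪u - u', S (u - u')⟫ / 2 : ℝ) : EReal)
      ≤ f w + ((⟪x, P w + p⟫ + σ / 2 * ‖P w + p‖ ^ 2
        + ⟪w - u', S (w - u')⟫ / 2 : ℝ) : EReal))
    {w : E} (hw : f w ≠ ⊤) :
    (f u).toReal - ⟪x + σ • (P u + p), P (w - u)⟫ - ⟪S (u - u'), w - u⟫ ≤ (f w).toReal := by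
  set K : ℝ := σ / 2 * ‖P (w - u)‖ ^ 2 + ⟪w - u, S (w - u)⟫ / 2 with hK
  have key : ∀ t : ℝ, 0 < t → t ≤ 1 →
      (f u).toReal - ⟪x + σ • (P u + p), P (w - u)⟫ - ⟪S (u - u'), w - u⟫
        ≤ (f w).toReal + t * K := by
    intro t ht0 ht1
    have h := (hmin (u + t • (w - u))).trans
      (add_le_add_left (hf.le_combo hu hw ht0.le ht1) _)
    rw [← hf.coe_toReal hu] at h
    have h' := EReal.coe_le_coe_iff.mp (by exact_mod_cast h :
      (((f u).toReal + (⟪x, P u + p⟫ + σ / 2 * ‖P u + p‖ ^ 2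
        + ⟪u - u', S (u - u')⟫ / 2) : ℝ) : EReal) ≤
      (((1 - t) * (f u).toReal + t * (f w).toReal + (⟪x, P (u + t • (w - u)) + p⟫
        + σ / 2 * ‖P (u + t • (w - u)) + p‖ ^ 2
        + ⟪u + t • (w - u) - u', S (u + t • (w - u) - u')⟫ / 2) : ℝ) : EReal))
    have e1 : P (u + t • (w - u)) + p = (P u + p) + t • P (w - u) := by
      rw [map_add, map_smul]; abel
    have e2 : u + t • (w - u) - u' = (u - u') + t • (w - u) := by abel
    rw [e1, e2] at h'
    generalize w - u = d at *
    generalize u - u' = q at *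
    generalize P u + p = a at *
    have hsq : ⟪q, S d⟫ = ⟪S q, d⟫ := (hS q d).symm
    have hsd : ⟪d, S q⟫ = ⟪S q, d⟫ := real_inner_comm _ _
    have h3 : ‖a + t • P d‖ ^ 2 = ‖a‖ ^ 2 + 2 * t * ⟪a, P d⟫ + t ^ 2 * ‖P d‖ ^ 2 := by
      rw [norm_add_sq_real, inner_smul_right, norm_smul, mul_pow, Real.norm_eq_abs, sq_abs]
      ring
    rw [h3] at h'
    simp only [map_add, map_smul, inner_add_left, inner_add_right, real_inner_smul_left,
      real_inner_smul_right, hsq, hsd] at h' hK ⊢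
    refine le_of_mul_le_mul_left ?_ ht0
    rw [hK]
    linarith
  have hlim : Tendsto (fun t : ℝ => (f w).toReal + t * K) (nhdsWithin 0 (Set.Ioi 0))
      (nhds (f w).toReal) := by
    have : Tendsto (fun t : ℝ => (f w).toReal + t * K) (nhds 0)
        (nhds ((f w).toReal + 0 * K)) := by
      apply Continuous.tendsto; fun_prop
    rw [zero_mul, add_zero] at this
    exact this.mono_left nhdsWithin_le_nhds
  refine ge_of_tendsto hlim ?_
  filter_upwards [Ioc_mem_nhdsGT (zero_lt_one' ℝ)] with t ht using key t ht.1 ht.2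

/-- A positive semidefinite operator vanishes wherever its quadratic form does. -/
lemma LinearMap.IsSymmetric.apply_eq_zero_of_inner_self_eq_zero {S : E →ₗ[ℝ] E}
    (hS : S.IsSymmetric) (hSpsd : ∀ w : E, 0 ≤ ⟪w, S w⟫) {d : E} (hd : ⟪d, S d⟫ = 0) :
    S d = 0 := by
  have key : ∀ t : ℝ, 0 ≤ ⟪S d, S (S d)⟫ * (t * t) + 2 * ‖S d‖ ^ 2 * t + 0 := by
    intro t
    have h := hSpsd (d + t • S d)
    have e : ⟪d, S (S d)⟫ = ‖S d‖ ^ 2 := by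
      rw [← hS d (S d), real_inner_self_eq_norm_sq]
    simp only [map_add, map_smul, inner_add_left, inner_add_right, real_inner_smul_left,
      real_inner_smul_right, hd, e, real_inner_self_eq_norm_sq] at h
    linarith
  have h := discrim_le_zero key
  rw [discrim, mul_zero, sub_zero] at h
  have h0 := pow_eq_zero_iff (two_ne_zero) |>.mp (le_antisymm h (sq_nonneg _))
  simpa using h0

/-- A sequence in a sublevel set of `f` along which `P` and the seminorm of `S` stay bounded is
bounded, provided `f` has no nonzero direction of recession in `ker P ∩ ker S`. -/
lemma isBounded_of_recession_pos {X : Type*} [NormedAddCommGroup X] [InnerProductSpace ℝ X]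
    [FiniteDimensional ℝ E] {f : E → EReal}
    (hf : ProperConvexLsc f) (P : E →ₗ[ℝ] X) (S : E →ₗ[ℝ] E) (hS : S.IsSymmetric)
    (hSpsd : ∀ w : E, 0 ≤ ⟪w, S w⟫) {frec : E → EReal} (hfrec : IsRecessionFn f frec)
    (hpos : ∀ w : E, w ≠ 0 → P w = 0 → S w = 0 → 0 < frec w)
    {ub : E} (hub : f ub ≠ ⊤) {u : ℕ → E} {M C : ℝ} (hM : ∀ k, f (u k) ≤ (M : EReal))
    (hP : ∀ k, ‖P (u k - ub)‖ ≤ C) (hSb : ∀ k, ⟪u k - ub, S (u k - ub)⟫ ≤ C) :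
    IsBounded (Set.range u) := by
  by_contra hunb
  have hfin : ∀ k, f (u k) ≠ ⊤ := fun k h => by simpa [h] using hM k
  have hMr : ∀ k, (f (u k)).toReal ≤ M := fun k => by
    have := hM k
    rw [← hf.coe_toReal (hfin k)] at this
    exact_mod_cast this
  have hbig : ∀ n : ℕ, ∃ k, (n : ℝ) + 1 < ‖u k - ub‖ := by
    by_contra! hcon
    obtain ⟨n, hn⟩ := hcon
    apply hunb
    refine (Metric.isBounded_closedBall (x := ub) (r := (n : ℝ) + 1)).subset ?_
    rintro _ ⟨k, rfl⟩
    rw [Metric.mem_closedBall, dist_eq_norm]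
    exact hn k
  choose κ hκ using hbig
  set s : ℕ → ℝ := fun n => ‖u (κ n) - ub‖⁻¹ with hs
  have hspos : ∀ n, 0 < ‖u (κ n) - ub‖ := fun n => lt_trans (by positivity) (hκ n)
  have hs0 : ∀ n, 0 ≤ s n := fun n => inv_nonneg.mpr (norm_nonneg _)
  have hslim : Tendsto s atTop (nhds 0) := by
    apply Filter.Tendsto.inv_tendsto_atTop
    refine tendsto_atTop_mono (fun n => (hκ n).le) ?_
    exact tendsto_atTop_add_const_right _ _ tendsto_natCast_atTop_atTop
  have hsph : ∀ n, s n • (u (κ n) - ub) ∈ Metric.sphere (0 : E) 1 := fun n => by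
    rw [mem_sphere_zero_iff_norm, norm_smul, Real.norm_eq_abs, abs_of_nonneg (hs0 n)]
    exact inv_mul_cancel₀ (hspos n).ne'
  have : ProperSpace E := FiniteDimensional.proper ℝ E
  obtain ⟨d, hd, φ, hφ, hlim⟩ := (isCompact_sphere (0 : E) 1).tendsto_subseq hsph
  have hsφ : Tendsto (fun n => s (φ n)) atTop (nhds 0) := hslim.comp hφ.tendsto_atTop
  have hd0 : d ≠ 0 := by
    rintro rfl
    simp at hd
  have hPc : Continuous P := P.continuous_of_finiteDimensional
  have hSc : Continuous S := S.continuous_of_finiteDimensional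
  have hPd : P d = 0 := by
    have h1 : Tendsto (fun n => ‖P (s (φ n) • (u (κ (φ n)) - ub))‖) atTop (nhds ‖P d‖) :=
      ((hPc.norm).tendsto d).comp hlim
    have h2 : ‖P d‖ ≤ 0 := by
      refine le_of_tendsto_of_tendsto' h1 (by simpa using hsφ.mul_const C) fun n => ?_
      rw [map_smul, norm_smul, Real.norm_eq_abs, abs_of_nonneg (hs0 _)]
      exact mul_le_mul_of_nonneg_left (hP _) (hs0 _)
    exact norm_le_zero_iff.mp h2
  have hSd0 : ⟪d, S d⟫ = 0 := by
    refine le_antisymm ?_ (hSpsd d)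
    have h1 : Tendsto (fun n => ⟪s (φ n) • (u (κ (φ n)) - ub),
        S (s (φ n) • (u (κ (φ n)) - ub))⟫) atTop (nhds ⟪d, S d⟫) :=
      ((continuous_id.inner hSc).tendsto d).comp hlim
    refine le_of_tendsto_of_tendsto' h1
      (by simpa using (hsφ.mul hsφ).mul_const C) fun n => ?_
    rw [map_smul, real_inner_smul_left, real_inner_smul_right, ← mul_assoc]
    exact mul_le_mul_of_nonneg_left (hSb _) (mul_nonneg (hs0 _) (hs0 _))
  have hSd : S d = 0 :=
    hS.apply_eq_zero_of_inner_self_eq_zero hSpsd hSd0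
  have hdir : ∀ ρ : ℝ, 0 < ρ → f (ub + ρ • d) ≤ f ub := by
    intro ρ hρ
    by_contra! hlt
    rw [← hf.coe_toReal hub] at hlt
    obtain ⟨q, hq1, hq2⟩ := EReal.lt_iff_exists_real_btwn.mp hlt
    have hq1' : (f ub).toReal < q := by exact_mod_cast hq1
    have hconv : Tendsto (fun n => ub + ρ • (s (φ n) • (u (κ (φ n)) - ub))) atTop
        (nhds (ub + ρ • d)) := (hlim.const_smul ρ).const_add ub
    have hev1 := hconv.eventually (hf.2.2.2 (ub + ρ • d) q hq2)
    have hρs : Tendsto (fun n => ρ * s (φ n)) atTop (nhds 0) := by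
      simpa using hsφ.const_mul ρ
    have hev2 := hρs.eventually (Iic_mem_nhds (zero_lt_one' ℝ))
    have hub' : Tendsto (fun n => (1 - ρ * s (φ n)) * (f ub).toReal + ρ * s (φ n) * M) atTop
        (nhds (f ub).toReal) := by
      simpa using ((hρs.const_sub 1).mul_const (f ub).toReal).add (hρs.mul_const M)
    have hev3 := hub'.eventually (Iio_mem_nhds hq1')
    obtain ⟨n, h1, h2, h3⟩ := (hev1.and (hev2.and hev3)).exists
    have h4 := hf.le_combo hub (hfin (κ (φ n))) (mul_nonneg hρ.le (hs0 (φ n))) h2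
    rw [mul_smul] at h4
    have h5 : q < (1 - ρ * s (φ n)) * (f ub).toReal
        + ρ * s (φ n) * (f (u (κ (φ n)))).toReal := by
      exact_mod_cast h1.trans_le h4
    have h6 := mul_le_mul_of_nonneg_left (hMr (κ (φ n))) (mul_nonneg hρ.le (hs0 (φ n)))
    have h7 : (1 - ρ * s (φ n)) * (f ub).toReal + ρ * s (φ n) * M < q := h3
    linarith
  refine (hpos d hd0 hPd hSd).not_ge (le_of_tendsto (hfrec ub hub d) ?_)
  filter_upwards [eventually_gt_atTop (0 : ℝ)] with ρ hρ
  refine EReal.mul_nonpos_iff.mpr (Or.inr ⟨?_, ?_⟩)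
  · rw [EReal.sub_nonpos]
    exact hdir ρ hρ
  · exact_mod_cast (inv_pos.mpr hρ).le

end Convex

section Energy

lemma two_mul_inner_symm {E : Type*} [NormedAddCommGroup E] [InnerProductSpace ℝ E]
    (S : E →ₗ[ℝ] E) (hS : S.IsSymmetric) (a b : E) :
    2 * ⟪S (b - a), b⟫ = ⟪b, S b⟫ + ⟪b - a, S (b - a)⟫ - ⟪a, S a⟫ := by
  have h1 : ⟪S b, b⟫ = ⟪b, S b⟫ := hS b b
  have h2 : ⟪S a, b⟫ = ⟪a, S b⟫ := hS a b
  have h3 : ⟪b, S a⟫ = ⟪a, S b⟫ := by rw [real_inner_comm]; exact h2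
  simp only [map_sub, inner_sub_left, inner_sub_right, h1, h2, h3]
  ring

lemma bddAbove_of_le_add_summable {Φ e : ℕ → ℝ} (he : Summable e) (he0 : ∀ k, 0 ≤ e k)
    (h : ∀ k, Φ (k + 1) ≤ Φ k + e k) : ∃ C, ∀ k, Φ k ≤ C := by
  have hk : ∀ k, Φ k ≤ Φ 0 + ∑ i ∈ Finset.range k, e i := by
    intro k
    induction k with
    | zero => simp
    | succ k ih => rw [Finset.sum_range_succ]; linarith [h k]
  exact ⟨Φ 0 + ∑' i, e i, fun k =>
    (hk k).trans (add_le_add_right (he.sum_le_tsum _ fun i _ => he0 i) _)⟩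

/-- One-step estimate for the multiplier and coupling terms of the sPADMM energy. -/
lemma energy_step {X : Type*} [NormedAddCommGroup X] [InnerProductSpace ℝ X]
    {σ τ sy sz : ℝ} (hσ : 0 < σ) (hτ : 0 < τ) {ξ ξ' u w w' : X}
    (hx : ξ' = ξ + (τ * σ) • (u + w'))
    (hy : ⟪ξ + σ • (u + w), u⟫ + sy ≤ 0)
    (hz : ⟪ξ + σ • (u + w'), w'⟫ + sz ≤ 0) :
    ‖ξ'‖ ^ 2 / (τ * σ) + σ * ‖w'‖ ^ 2 + 2 * sy + 2 * sz
      ≤ ‖ξ‖ ^ 2 / (τ * σ) + σ * ‖w‖ ^ 2 + (τ - 2) * (σ * ‖u + w'‖ ^ 2)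
        + 2 * σ * ⟪u + w', w' - w⟫ - σ * ‖w' - w‖ ^ 2 := by
  have hts : 0 < τ * σ := mul_pos hτ hσ
  have e : ‖ξ'‖ ^ 2 / (τ * σ)
      = ‖ξ‖ ^ 2 / (τ * σ) + 2 * ⟪ξ, u + w'⟫ + τ * (σ * ‖u + w'‖ ^ 2) := by
    rw [hx, norm_add_sq_real, inner_smul_right, norm_smul, mul_pow, Real.norm_eq_abs, sq_abs]
    field_simp
  rw [e]
  simp only [← real_inner_self_eq_norm_sq, inner_add_left, inner_add_right, inner_sub_left,
    inner_sub_right, real_inner_smul_left] at hy hz ⊢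
  rw [real_inner_comm u w] at *
  rw [real_inner_comm u w'] at *
  rw [real_inner_comm w w'] at *
  linarith

/-- Boundedness of the sPADMM energy, for iterates recentred at a KKT point. -/
lemma energy_bounded {X : Type*} [NormedAddCommGroup X] [InnerProductSpace ℝ X]
    {Y : Type*} [NormedAddCommGroup Y] [InnerProductSpace ℝ Y]
    {Z : Type*} [NormedAddCommGroup Z] [InnerProductSpace ℝ Z]
    (P : Y →ₗ[ℝ] X) (Q : Z →ₗ[ℝ] X) {σ τ : ℝ} (hσ : 0 < σ) (hτ : 0 < τ)
    (S : Y →ₗ[ℝ] Y) (hS : S.IsSymmetric) (hSpsd : ∀ w : Y, 0 ≤ ⟪w, S w⟫)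
    (T : Z →ₗ[ℝ] Z) (hT : T.IsSymmetric) (hTpsd : ∀ w : Z, 0 ≤ ⟪w, T w⟫)
    {ξ : ℕ → X} {η : ℕ → Y} {ζ : ℕ → Z}
    (hx : ∀ k, ξ (k + 1) = ξ k + (τ * σ) • (P (η (k + 1)) + Q (ζ (k + 1))))
    (hy : ∀ k, ⟪ξ k + σ • (P (η (k + 1)) + Q (ζ k)), P (η (k + 1))⟫
      + ⟪S (η (k + 1) - η k), η (k + 1)⟫ ≤ 0)
    (hz : ∀ k, ⟪ξ k + σ • (P (η (k + 1)) + Q (ζ (k + 1))), Q (ζ (k + 1))⟫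
      + ⟪T (ζ (k + 1) - ζ k), ζ (k + 1)⟫ ≤ 0)
    (hzz : ∀ k, ⟪(ξ (k + 1) + σ • (P (η (k + 2)) + Q (ζ (k + 2))))
        - (ξ k + σ • (P (η (k + 1)) + Q (ζ (k + 1)))), Q (ζ (k + 2) - ζ (k + 1))⟫
      + ⟪T ((ζ (k + 2) - ζ (k + 1)) - (ζ (k + 1) - ζ k)), ζ (k + 2) - ζ (k + 1)⟫ ≤ 0)
    (hC : CondC τ ξ) :
    ∃ C, ∀ k, ‖ξ k‖ ^ 2 / (τ * σ) + σ * ‖Q (ζ k)‖ ^ 2 + ⟪η k, S (η k)⟫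
      + ⟪ζ k, T (ζ k)⟫ ≤ C := by
  set Φ : ℕ → ℝ := fun k => ‖ξ k‖ ^ 2 / (τ * σ) + σ * ‖Q (ζ k)‖ ^ 2 + ⟪η k, S (η k)⟫
      + ⟪ζ k, T (ζ k)⟫ with hΦ
  set r : ℕ → X := fun k => P (η k) + Q (ζ k) with hr
  have hts : 0 < τ * σ := mul_pos hτ hσ
  have step : ∀ k, Φ (k + 1) + ⟪ζ (k + 1) - ζ k, T (ζ (k + 1) - ζ k)⟫ ≤ Φ k
      + (τ - 2) * (σ * ‖r (k + 1)‖ ^ 2)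
      + 2 * σ * ⟪r (k + 1), Q (ζ (k + 1)) - Q (ζ k)⟫ - σ * ‖Q (ζ (k + 1)) - Q (ζ k)‖ ^ 2 := by
    intro k
    have h := energy_step hσ hτ (hx k) (hy k) (hz k)
    rw [two_mul_inner_symm S hS, two_mul_inner_symm T hT] at h
    have := hSpsd (η (k + 1) - η k)
    simp only [hΦ, hr]
    linarith
  have young : ∀ (t : ℝ) (a b : X), 2 * t * ⟪a, b⟫ ≤ t ^ 2 * ‖a‖ ^ 2 + ‖b‖ ^ 2 := by
    intro t a b
    have h := sq_nonneg ‖t • a - b‖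
    rw [norm_sub_sq_real, real_inner_smul_left, norm_smul, mul_pow, Real.norm_eq_abs,
      sq_abs] at h
    linarith
  rcases hC with ⟨-, hlt⟩ | ⟨hge, hsum⟩
  · have h5 : Real.sqrt 5 ^ 2 = 5 := Real.sq_sqrt (by norm_num)
    have h51 : 1 ≤ Real.sqrt 5 := Real.one_le_sqrt.mpr (by norm_num)
    have hgold : (1 - τ) ^ 2 ≤ 2 - τ := by
      nlinarith [mul_pos (sub_pos.mpr hlt)
        (by linarith : 0 < τ + (1 + Real.sqrt 5) / 2 - 1)]
    have hτ2 : 0 ≤ 2 - τ := (sq_nonneg _).trans hgold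
    set Ψ : ℕ → ℝ := fun k => Φ (k + 1) + ⟪ζ (k + 1) - ζ k, T (ζ (k + 1) - ζ k)⟫
      + (2 - τ) * (σ * ‖r (k + 1)‖ ^ 2) with hΨ
    have hmono : Antitone Ψ := by
      refine antitone_nat_of_succ_le fun k => ?_
      have h1 := step (k + 1)
      have h2 := hzz k
      have e : (ξ (k + 1) + σ • (P (η (k + 2)) + Q (ζ (k + 2))))
          - (ξ k + σ • (P (η (k + 1)) + Q (ζ (k + 1))))
          = σ • r (k + 2) - (σ * (1 - τ)) • r (k + 1) := by
        rw [hx k]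
        simp only [hr]
        module
      rw [e, inner_sub_left, real_inner_smul_left, real_inner_smul_left, map_sub Q] at h2
      have h3 := two_mul_inner_symm T hT (ζ (k + 1) - ζ k) (ζ (k + 2) - ζ (k + 1))
      have h4 := hTpsd ((ζ (k + 2) - ζ (k + 1)) - (ζ (k + 1) - ζ k))
      have h6 := mul_le_mul_of_nonneg_left
        (young (1 - τ) (r (k + 1)) (Q (ζ (k + 2)) - Q (ζ (k + 1)))) hσ.le
      have h7 := mul_le_mul_of_nonneg_right hgold
        (mul_nonneg hσ.le (sq_nonneg ‖r (k + 1)‖))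
      have h8 := hTpsd (ζ (k + 2) - ζ (k + 1))
      simp only [hΨ]
      simp only [add_assoc, one_add_one_eq_two] at *
      linarith
    refine ⟨max (Φ 0) (Ψ 0), fun k => ?_⟩
    rcases k with _ | k
    · exact le_max_left _ _
    · have h1 := hmono (Nat.zero_le k)
      have h2 := hTpsd (ζ (k + 1) - ζ k)
      have h3 := mul_nonneg hτ2 (mul_nonneg hσ.le (sq_nonneg ‖r (k + 1)‖))
      refine le_max_of_le_right (le_trans ?_ h1)
      simp only [hΨ, hΦ] at *
      linarith
  · have h5 : 1 ≤ Real.sqrt 5 := Real.one_le_sqrt.mpr (by norm_num)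
    have hτ1 : 0 ≤ τ - 1 := by linarith
    have hrs : ∀ k, ‖ξ (k + 1) - ξ k‖ ^ 2 = (τ * σ) ^ 2 * ‖r (k + 1)‖ ^ 2 := by
      intro k
      rw [hx k, add_sub_cancel_left, norm_smul, mul_pow, Real.norm_eq_abs, sq_abs]
    have hsr : Summable fun k => (τ - 1) * (σ * ‖r (k + 1)‖ ^ 2) := by
      refine Summable.mul_left _ (Summable.mul_left _ ?_)
      simp only [hrs] at hsum
      exact (summable_mul_left_iff (pow_pos hts 2).ne').mp hsum
    refine bddAbove_of_le_add_summable hsr (fun k => by positivity) fun k => ?_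
    have h1 := step k
    have h2 := mul_le_mul_of_nonneg_left
      (young 1 (r (k + 1)) (Q (ζ (k + 1)) - Q (ζ k))) hσ.le
    have h3 := hTpsd (ζ (k + 1) - ζ k)
    linarith

end Energy

/-- Two-sided bounds on the values of `f` along proximal iterates with bounded residuals. -/
lemma values_bounded {X : Type*} [NormedAddCommGroup X] [InnerProductSpace ℝ X]
    {E : Type*} [NormedAddCommGroup E] [InnerProductSpace ℝ E]
    {φ : E → ℝ} (P : E →ₗ[ℝ] X) (S : E →ₗ[ℝ] E) (hS : S.IsSymmetric)
    (hSpsd : ∀ w : E, 0 ≤ ⟪w, S w⟫) {ub : E} {u : ℕ → E} {p : ℕ → X} {xb : X} {C : ℝ}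
    (hlow : ∀ k, φ ub - ⟪xb, P (u k - ub)⟫ ≤ φ (u k))
    (hupp : ∀ k, φ (u (k + 1)) - ⟪p k, P (ub - u (k + 1))⟫
      - ⟪S (u (k + 1) - u k), ub - u (k + 1)⟫ ≤ φ ub)
    (hp : ∀ k, ‖p k‖ ≤ C) (hP : ∀ k, ‖P (u k - ub)‖ ≤ C)
    (hSb : ∀ k, ⟪u k - ub, S (u k - ub)⟫ ≤ C) :
    ∃ m M : ℝ, ∀ k, m ≤ φ (u k) ∧ φ (u k) ≤ M := by
  have hC : 0 ≤ C := (norm_nonneg _).trans (hp 0)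
  refine ⟨φ ub - ‖xb‖ * C, max (φ (u 0)) (φ ub + C * C + C), fun k => ⟨?_, ?_⟩⟩
  · have h1 := real_inner_le_norm xb (P (u k - ub))
    have h2 := mul_le_mul_of_nonneg_left (hP k) (norm_nonneg xb)
    linarith [hlow k]
  · rcases k with _ | k
    · exact le_max_left _ _
    · refine le_max_of_le_right ?_
      have h1 := real_inner_le_norm (p k) (P (ub - u (k + 1)))
      rw [← neg_sub (u (k + 1)) ub, map_neg, norm_neg] at h1
      have h2 := mul_le_mul (hp k) (hP (k + 1)) (norm_nonneg _) hC
      have h3 := two_mul_inner_symm S hS (u k - ub) (u (k + 1) - ub)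
      rw [sub_sub_sub_cancel_right] at h3
      have h4 := hSpsd (u (k + 1) - ub)
      have h5 := hSpsd (u (k + 1) - u k)
      have h6 := hupp k
      rw [← neg_sub (u (k + 1)) ub, map_neg, inner_neg_right, inner_neg_right] at h6
      rw [inner_neg_right] at h1
      linarith [hSb k]

lemma add_le_add_coe_right_iff {a b : EReal} {r : ℝ} :
    a + (r : EReal) ≤ b + (r : EReal) ↔ a ≤ b :=
  (EReal.addLECancellable_coe r).add_le_add_iff_right

section Subproblems

variable {f : Y → EReal} {g : Z → EReal} {A : X →ₗ[ℝ] Y} {B : X →ₗ[ℝ] Z} {c : X} {σ : ℝ}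
  {S : Y →ₗ[ℝ] Y} {T : Z →ₗ[ℝ] Z} {x' : X} {y' : Y} {z' : Z}

lemma ysub_eq (hg : ProperConvexLsc g) (hz : g z' ≠ ⊤) (w : Y) :
    ysub f g A B c σ S x' y' z' w
      = f w + ((⟪x', LinearMap.adjoint A w + (LinearMap.adjoint B z' - c)⟫
        + σ / 2 * ‖LinearMap.adjoint A w + (LinearMap.adjoint B z' - c)‖ ^ 2
        + ⟪w - y', S (w - y')⟫ / 2 : ℝ) : EReal) + ((g z').toReal : EReal) := by
  rw [ysub, augL, ← hg.coe_toReal hz, EReal.toReal_coe, ← add_sub_assoc]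
  push_cast
  simp only [add_assoc, add_comm ((g z').toReal : EReal)]

lemma zsub_eq (hf : ProperConvexLsc f) (hy : f y' ≠ ⊤) (w : Z) :
    zsub f g A B c σ T x' y' z' w
      = g w + ((⟪x', LinearMap.adjoint B w + (LinearMap.adjoint A y' - c)⟫
        + σ / 2 * ‖LinearMap.adjoint B w + (LinearMap.adjoint A y' - c)‖ ^ 2
        + ⟪w - z', T (w - z')⟫ / 2 : ℝ) : EReal) + ((f y').toReal : EReal) := by
  rw [zsub, augL, ← hf.coe_toReal hy, EReal.toReal_coe, ← add_sub_assoc,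
    add_comm (LinearMap.adjoint B w), add_comm ((f y').toReal : EReal)]
  push_cast
  simp only [add_assoc, add_comm ((f y').toReal : EReal)]

end Subproblems

/-- **Theorem 1(b).**  If the KKT system has a solution and Condition (C) holds, then the
real sequences `{f(y^k)}` and `{g(z^k)}` are bounded; if moreover `f0⁺(w) > 0` for every
nonzero `w` with `A*w = 0`, `S w = 0`, and `g0⁺(w) > 0` for every nonzero `w` with
`B*w = 0`, `T w = 0`, then `{y^k}` and `{z^k}` are bounded. -/
theorem stmt_17
    (f : Y → EReal) (g : Z → EReal)
    (hf : ProperConvexLsc f) (hg : ProperConvexLsc g)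
    (A : X →ₗ[ℝ] Y) (B : X →ₗ[ℝ] Z) (c : X)
    (σ τ : ℝ) (hσ : 0 < σ) (hτ : 0 < τ)
    (S : Y →ₗ[ℝ] Y) (hSsym : S.IsSymmetric) (hSpsd : ∀ w : Y, 0 ≤ ⟪w, S w⟫)
    (T : Z →ₗ[ℝ] Z) (hTsym : T.IsSymmetric) (hTpsd : ∀ w : Z, 0 ≤ ⟪w, T w⟫)
    (xb : X) (yb : Y) (zb : Z) (hkkt : IsKKT f g A B c xb yb zb)
    (x : ℕ → X) (y : ℕ → Y) (z : ℕ → Z)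
    (hseq : IsSPADMM f g A B c σ τ S T x y z)
    (hC : CondC τ x)
    (frec : Y → EReal) (hfrec : IsRecessionFn f frec)
    (grec : Z → EReal) (hgrec : IsRecessionFn g grec) :
    (∃ m M : ℝ, ∀ k : ℕ,
      ((m : EReal) ≤ f (y k) ∧ f (y k) ≤ (M : EReal)) ∧
      ((m : EReal) ≤ g (z k) ∧ g (z k) ≤ (M : EReal))) ∧
    ((∀ w : Y, w ≠ 0 → (LinearMap.adjoint A) w = 0 → S w = 0 → 0 < frec w) →
      (∀ w : Z, w ≠ 0 → (LinearMap.adjoint B) w = 0 → T w = 0 → 0 < grec w) →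
      IsBounded (Set.range y) ∧ IsBounded (Set.range z)) := by
  obtain ⟨hk1, hk2, hk3⟩ := hkkt
  obtain ⟨hy0, hz0, hymin, hzmin, hxs⟩ := hseq
  have hfb := subdiff_ne_top hf hk1
  have hgb := subdiff_ne_top hg hk2
  have hfin : ∀ k, f (y k) ≠ ⊤ ∧ g (z k) ≠ ⊤ := by
    intro k
    induction k with
    | zero => exact ⟨hy0, hz0⟩
    | succ k ih =>
      have h1 : f (y (k + 1)) ≠ ⊤ := fun h => by
        have h' := hymin k (y k)
        rw [ysub_eq hg ih.2, ysub_eq hg ih.2, add_le_add_coe_right_iff, h, EReal.top_add_coe,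
          ← hf.coe_toReal ih.1] at h'
        exact EReal.coe_ne_top _ (top_le_iff.mp (by exact_mod_cast h'))
      refine ⟨h1, fun h => ?_⟩
      have h' := hzmin k (z k)
      rw [zsub_eq hf h1, zsub_eq hf h1, add_le_add_coe_right_iff, h, EReal.top_add_coe,
        ← hg.coe_toReal ih.2] at h'
      exact EReal.coe_ne_top _ (top_le_iff.mp (by exact_mod_cast h'))
  set P := LinearMap.adjoint A
  set Q := LinearMap.adjoint B
  have hopty : ∀ k w, f w ≠ ⊤ → (f (y (k + 1))).toReal
      - ⟪x k + σ • (P (y (k + 1)) + (Q (z k) - c)), P (w - y (k + 1))⟫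
      - ⟪S (y (k + 1) - y k), w - y (k + 1)⟫ ≤ (f w).toReal := by
    intro k w hw
    refine prox_optimality hf P S hSsym σ (x k) (Q (z k) - c) (hfin (k + 1)).1 (fun v => ?_) hw
    have h := hymin k v
    rwa [ysub_eq hg (hfin k).2, ysub_eq hg (hfin k).2, add_le_add_coe_right_iff] at h
  have hoptz : ∀ k w, g w ≠ ⊤ → (g (z (k + 1))).toReal
      - ⟪x k + σ • (Q (z (k + 1)) + (P (y (k + 1)) - c)), Q (w - z (k + 1))⟫
      - ⟪T (z (k + 1) - z k), w - z (k + 1)⟫ ≤ (g w).toReal := by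
    intro k w hw
    refine prox_optimality hg Q T hTsym σ (x k) (P (y (k + 1)) - c) (hfin (k + 1)).2
      (fun v => ?_) hw
    have h := hzmin k v
    rwa [zsub_eq hf (hfin (k + 1)).1, zsub_eq hf (hfin (k + 1)).1,
      add_le_add_coe_right_iff] at h
  have hlowy : ∀ k, (f yb).toReal - ⟪xb, P (y k - yb)⟫ ≤ (f (y k)).toReal := by
    intro k
    have h := subdiff_toReal hf hk1 (hfin k).1
    rwa [inner_neg_left, ← LinearMap.adjoint_inner_right, ← sub_eq_add_neg] at h
  have hlowz : ∀ k, (g zb).toReal - ⟪xb, Q (z k - zb)⟫ ≤ (g (z k)).toReal := by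
    intro k
    have h := subdiff_toReal hg hk2 (hfin k).2
    rwa [inner_neg_left, ← LinearMap.adjoint_inner_right, ← sub_eq_add_neg] at h
  have hres : ∀ i j, P (y i) + (Q (z j) - c) = P (y i - yb) + Q (z j - zb) := by
    intro i j
    rw [← hk3, map_sub, map_sub]
    abel
  have hres' : ∀ i j, Q (z j) + (P (y i) - c) = P (y i - yb) + Q (z j - zb) := by
    intro i j
    rw [← hres]
    abel
  simp only [hres] at hopty
  simp only [hres'] at hoptz
  obtain ⟨C, hCb⟩ := energy_bounded P Q hσ hτ S hSsym hSpsd T hTsym hTpsd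
    (ξ := fun k => x k - xb) (η := fun k => y k - yb) (ζ := fun k => z k - zb)
    (fun k => by
      simp only [← hres]
      rw [hxs k, ← add_sub_assoc]
      abel)
    (fun k => by
      have h1 := hopty k yb hfb
      have h2 := hlowy (k + 1)
      rw [← neg_sub (y (k + 1)) yb, map_neg, inner_neg_right, inner_neg_right] at h1
      rw [sub_sub_sub_cancel_right, sub_add_eq_add_sub, inner_sub_left]
      linarith)
    (fun k => by
      have h1 := hoptz k zb hgb
      have h2 := hlowz (k + 1)
      rw [← neg_sub (z (k + 1)) zb, map_neg, inner_neg_right, inner_neg_right] at h1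
      rw [sub_sub_sub_cancel_right, sub_add_eq_add_sub, inner_sub_left]
      linarith)
    (fun k => by
      have h1 := hoptz k (z (k + 2)) (hfin _).2
      have h2 := hoptz (k + 1) (z (k + 1)) (hfin _).2
      rw [← neg_sub (z (k + 1 + 1)) (z (k + 1)), map_neg, inner_neg_right,
        inner_neg_right] at h2
      simp only [sub_sub_sub_cancel_right, sub_add_eq_add_sub _ xb, map_sub T,
        inner_sub_left] at *
      simp only [add_assoc, one_add_one_eq_two] at *
      linarith)
    (by simpa only [CondC, sub_sub_sub_cancel_right] using hC)
  have hts : 0 < τ * σ := mul_pos hτ hσ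
  have hterms : ∀ k, ‖x k - xb‖ ^ 2 ≤ C * (τ * σ) ∧ ‖Q (z k - zb)‖ ^ 2 ≤ C / σ
      ∧ ⟪y k - yb, S (y k - yb)⟫ ≤ C ∧ ⟪z k - zb, T (z k - zb)⟫ ≤ C := by
    intro k
    have h := hCb k
    have h1 : 0 ≤ ‖x k - xb‖ ^ 2 / (τ * σ) := by positivity
    have h2 : 0 ≤ σ * ‖Q (z k - zb)‖ ^ 2 := by positivity
    have h3 := hSpsd (y k - yb)
    have h4 := hTpsd (z k - zb)
    refine ⟨(div_le_iff₀ hts).mp (by linarith), (le_div_iff₀ hσ).mpr (by linarith), ?_, ?_⟩ <;>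
      linarith
  have hxi : ∀ k, ‖x k - xb‖ ≤ Real.sqrt (C * (τ * σ)) := fun k =>
    Real.le_sqrt_of_sq_le (hterms k).1
  have hQz : ∀ k, ‖Q (z k - zb)‖ ≤ Real.sqrt (C / σ) := fun k =>
    Real.le_sqrt_of_sq_le (hterms k).2.1
  obtain ⟨D, hPy⟩ : ∃ D, ∀ k, ‖P (y k - yb)‖ ≤ D := by
    refine ⟨max ‖P (y 0 - yb)‖ ((τ * σ)⁻¹ * (2 * Real.sqrt (C * (τ * σ)))
      + Real.sqrt (C / σ)), fun k => ?_⟩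
    rcases k with _ | k
    · exact le_max_left _ _
    · refine le_max_of_le_right ?_
      have e : P (y (k + 1) - yb)
          = (τ * σ)⁻¹ • ((x (k + 1) - xb) - (x k - xb)) - Q (z (k + 1) - zb) := by
        rw [sub_sub_sub_cancel_right, hxs k, add_sub_cancel_left, inv_smul_smul₀ hts.ne',
          add_sub_assoc, hres, add_sub_cancel_right]
      rw [e]
      refine (norm_sub_le _ _).trans (add_le_add ?_ (hQz _))
      rw [norm_smul, Real.norm_of_nonneg (inv_pos.mpr hts).le]
      refine mul_le_mul_of_nonneg_left ?_ (inv_pos.mpr hts).le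
      refine (norm_sub_le _ _).trans ?_
      linarith [hxi k, hxi (k + 1)]
  have hmult : ∀ i j k, ‖x i + σ • (P (y j - yb) + Q (z k - zb))‖
      ≤ ‖xb‖ + Real.sqrt (C * (τ * σ)) + σ * (D + Real.sqrt (C / σ)) := by
    intro i j k
    refine (norm_add_le _ _).trans (add_le_add ?_ ?_)
    · have h := norm_add_le xb (x i - xb)
      rw [add_sub_cancel] at h
      linarith [hxi i]
    · rw [norm_smul, Real.norm_of_nonneg hσ.le]
      refine mul_le_mul_of_nonneg_left ?_ hσ.le
      exact (norm_add_le _ _).trans (add_le_add (hPy _) (hQz _))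
  set R := max C (max D (max (Real.sqrt (C / σ))
    (‖xb‖ + Real.sqrt (C * (τ * σ)) + σ * (D + Real.sqrt (C / σ)))))
  have hRC : C ≤ R := le_max_left _ _
  have hRD : D ≤ R := (le_max_left _ _).trans (le_max_right _ _)
  have hRQ : Real.sqrt (C / σ) ≤ R :=
    (le_max_left _ _).trans ((le_max_right _ _).trans (le_max_right _ _))
  have hRM : ‖xb‖ + Real.sqrt (C * (τ * σ)) + σ * (D + Real.sqrt (C / σ)) ≤ R :=
    (le_max_right _ _).trans ((le_max_right _ _).trans (le_max_right _ _))
  obtain ⟨m₁, M₁, hb₁⟩ := values_bounded (φ := fun w => (f w).toReal) P S hSsym hSpsd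
    hlowy (fun k => hopty k yb hfb) (fun k => (hmult _ _ _).trans hRM)
    (fun k => (hPy k).trans hRD) (fun k => (hterms k).2.2.1.trans hRC)
  obtain ⟨m₂, M₂, hb₂⟩ := values_bounded (φ := fun w => (g w).toReal) Q T hTsym hTpsd
    hlowz (fun k => hoptz k zb hgb) (fun k => (hmult _ _ _).trans hRM)
    (fun k => (hQz k).trans hRQ) (fun k => (hterms k).2.2.2.trans hRC)
  have hfM : ∀ k, f (y k) ≤ (M₁ : EReal) := fun k => by
    rw [← hf.coe_toReal (hfin k).1]
    exact_mod_cast (hb₁ k).2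
  have hgM : ∀ k, g (z k) ≤ (M₂ : EReal) := fun k => by
    rw [← hg.coe_toReal (hfin k).2]
    exact_mod_cast (hb₂ k).2
  refine ⟨⟨min m₁ m₂, max M₁ M₂, fun k => ?_⟩, fun hfpos hgpos => ⟨?_, ?_⟩⟩
  · rw [← hf.coe_toReal (hfin k).1, ← hg.coe_toReal (hfin k).2]
    simp only [EReal.coe_le_coe_iff]
    exact ⟨⟨(min_le_left _ _).trans (hb₁ k).1, (hb₁ k).2.trans (le_max_left _ _)⟩,
      (min_le_right _ _).trans (hb₂ k).1, (hb₂ k).2.trans (le_max_right _ _)⟩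
  · exact isBounded_of_recession_pos hf P S hSsym hSpsd hfrec hfpos hfb hfM
      (fun k => (hPy k).trans hRD) (fun k => (hterms k).2.2.1.trans hRC)
  · exact isBounded_of_recession_pos hg Q T hTsym hTpsd hgrec hgpos hgb hgM
      (fun k => (hQz k).trans hRQ) (fun k => (hterms k).2.2.2.trans hRC)
end
end

section
/- Assume the KKT system has a solution, let {(x^k,y^k,z^k)}_{k≥0} be an infinite sequence generated by the sPADMM, and assume Condition (C) holds. Then every accumulation point (x^∞,y^∞,z^∞) of {(x^k,y^k,z^k)} solves the KKT system; moreover, for any such accumulation point, A*y^k → A*y^∞, (Σ_f + S)y^k → (Σ_f + S)y^∞, B*z^k → B*z^∞, and (Σ_g + T)z^k → (Σ_g + T)z^∞ as k → ∞ (along the whole sequence). -/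
open scoped RealInnerProductSpace
open Filter Bornology

noncomputable section

variable {X Y Z : Type*}
variable [NormedAddCommGroup X] [InnerProductSpace ℝ X] [FiniteDimensional ℝ X]
variable [NormedAddCommGroup Y] [InnerProductSpace ℝ Y] [FiniteDimensional ℝ Y]
variable [NormedAddCommGroup Z] [InnerProductSpace ℝ Z] [FiniteDimensional ℝ Z]

lemma subdiff_closed {E : Type*} [NormedAddCommGroup E] [InnerProductSpace ℝ E]
    {f : E → EReal} (hbot : ∀ u, f u ≠ ⊥)
    (hf : LowerSemicontinuous f) {u v : ℕ → E} {u₀ v₀ : E}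
    (hu : Tendsto u atTop (nhds u₀)) (hv : Tendsto v atTop (nhds v₀))
    (huv : ∀ᶠ n in atTop, v n ∈ subdiff f (u n)) : v₀ ∈ subdiff f u₀ := by
  intro w
  have hlim : Tendsto (fun n => ⟪v n, w - u n⟫) atTop (nhds ⟪v₀, w - u₀⟫) :=
    hv.inner (tendsto_const_nhds.sub hu)
  rcases eq_or_ne (f w) ⊤ with hw | hw
  · simp [hw]
  have hw' : f w ≠ ⊥ := by
    obtain ⟨n, hn⟩ := huv.exists
    intro h
    have := hn w
    rw [h, le_bot_iff, EReal.add_eq_bot_iff] at this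
    simp [hbot] at this
  lift f w to ℝ using ⟨hw, hw'⟩ with b hb
  by_contra! hlt
  have hlt' : ((b - ⟪v₀, w - u₀⟫ : ℝ) : EReal) < f u₀ := by
    rw [EReal.coe_sub]
    exact EReal.sub_lt_of_lt_add hlt
  obtain ⟨a, ha, ha'⟩ := EReal.lt_iff_exists_real_btwn.1 hlt'
  have hev : ∀ᶠ n in atTop, a + ⟪v n, w - u n⟫ ≤ b := by
    filter_upwards [huv, hu.eventually (hf u₀ a ha')] with n hn hn'
    have := (add_le_add_left hn'.le ((⟪v n, w - u n⟫ : ℝ) : EReal)).trans (hn w)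
    rw [← hb] at this
    exact_mod_cast this
  have h1 := le_of_tendsto (hlim.const_add a) hev
  have h2 : b - ⟪v₀, w - u₀⟫ < a := by exact_mod_cast ha
  linarith

/-- First-order optimality for a convex function plus a quadratic. -/
lemma neg_mem_subdiff_of_isMin {E : Type*} [NormedAddCommGroup E] [InnerProductSpace ℝ E]
    {h : E → EReal} (hh : ProperConvexLsc h) {q Q : E → ℝ} {u p : E} (hu : h u ≠ ⊤)
    (hmin : ∀ w, h u + (q u : EReal) ≤ h w + (q w : EReal))
    (hq : ∀ w, ∀ t : ℝ, q (u + t • (w - u)) = q u + t * ⟪p, w - u⟫ + t ^ 2 * Q w) :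
    -p ∈ subdiff h u := by
  obtain ⟨-, hbot, hconv, -⟩ := hh
  intro w
  rcases eq_or_ne (h w) ⊤ with hw | hw
  · simp [hw]
  lift h u to ℝ using ⟨hu, hbot u⟩ with a ha
  lift h w to ℝ using ⟨hw, hbot w⟩ with b hb
  have key : ∀ t : ℝ, 0 < t → t ≤ 1 → a ≤ b + ⟪p, w - u⟫ + t * Q w := by
    intro t ht ht1
    have h1 := hconv u w (1 - t) t (by linarith) ht.le (by ring)
    have h2 : (1 - t) • u + t • w = u + t • (w - u) := by module
    rw [h2, ← ha, ← hb] at h1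
    have h3 := (hmin (u + t • (w - u))).trans (add_le_add_left h1 _)
    rw [hq] at h3
    norm_cast at h3
    have h4 : 0 ≤ t * (b + ⟪p, w - u⟫ + t * Q w - a) := by linarith
    linarith [nonneg_of_mul_nonneg_right h4 ht]
  have hlim : Tendsto (fun t : ℝ => b + ⟪p, w - u⟫ + t * Q w) (nhdsWithin 0 (Set.Ioi 0))
      (nhds (b + ⟪p, w - u⟫ + 0 * Q w)) :=
    (Continuous.tendsto (by fun_prop) 0).mono_left nhdsWithin_le_nhds
  have := ge_of_tendsto hlim (by
    filter_upwards [Ioc_mem_nhdsGT (zero_lt_one' ℝ)] with t ht using key t ht.1 ht.2)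
  rw [inner_neg_left]
  norm_cast
  linarith

/-- Optimality condition of a proximal augmented Lagrangian subproblem. -/
lemma subproblem_optimality {E : Type*} [NormedAddCommGroup E] [InnerProductSpace ℝ E]
    [FiniteDimensional ℝ E] {h : E → EReal} (hh : ProperConvexLsc h)
    (M : X →ₗ[ℝ] E) (b ξ : X) (σ γ : ℝ) {P : E →ₗ[ℝ] E} (hP : P.IsSymmetric) {u v : E}
    (hu : h u ≠ ⊤) {q : E → ℝ}
    (hq : ∀ w, q w = γ + ⟪ξ, LinearMap.adjoint M w + b⟫
      + σ / 2 * ‖LinearMap.adjoint M w + b‖ ^ 2 + ⟪w - v, P (w - v)⟫ / 2)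
    (hmin : ∀ w, h u + (q u : EReal) ≤ h w + (q w : EReal)) :
    -(M (ξ + σ • (LinearMap.adjoint M u + b)) + P (u - v)) ∈ subdiff h u := by
  refine neg_mem_subdiff_of_isMin hh (q := q) hu hmin
    (Q := fun w => σ / 2 * ‖LinearMap.adjoint M (w - u)‖ ^ 2 + ⟪w - u, P (w - u)⟫ / 2) ?_
  intro w t
  have h1 : LinearMap.adjoint M (u + t • (w - u)) + b
      = (LinearMap.adjoint M u + b) + t • LinearMap.adjoint M (w - u) := by
    rw [map_add, map_smul]; abel
  have h2 : u + t • (w - u) - v = (u - v) + t • (w - u) := by abel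
  have h3 : ⟪u - v, P (w - u)⟫ = ⟪P (u - v), w - u⟫ := (hP _ _).symm
  have h4 : ⟪w - u, P (u - v)⟫ = ⟪P (u - v), w - u⟫ := real_inner_comm _ _
  have h5 : ∀ a, ⟪M a, w - u⟫ = ⟪a, LinearMap.adjoint M (w - u)⟫ := fun a =>
    (LinearMap.adjoint_inner_right M a (w - u)).symm
  rw [hq, hq, h1, h2, norm_add_sq_real, norm_smul, mul_pow, Real.norm_eq_abs, sq_abs]
  generalize LinearMap.adjoint M (w - u) = d at *
  generalize LinearMap.adjoint M u + b = s at *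
  generalize w - u = e at *
  generalize u - v = e' at *
  simp only [map_add, map_smul, inner_add_left, inner_add_right, real_inner_smul_left,
    real_inner_smul_right, h3, h4, h5]
  ring

section PosSemidef

variable {E : Type*} [NormedAddCommGroup E] [InnerProductSpace ℝ E] {P : E →ₗ[ℝ] E}

lemma two_inner_sub_eq (hP : P.IsSymmetric) (u v : E) :
    2 * ⟪P (u - v), u⟫ = ⟪u, P u⟫ - ⟪v, P v⟫ + ⟪u - v, P (u - v)⟫ := by
  have h1 : ⟪P v, u⟫ = ⟪u, P v⟫ := real_inner_comm _ _
  have h2 : ⟪v, P u⟫ = ⟪u, P v⟫ := by rw [← hP, real_inner_comm]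
  have h3 : ⟪P u, u⟫ = ⟪u, P u⟫ := real_inner_comm _ _
  simp only [map_sub, inner_sub_left, inner_sub_right, h1, h2, h3]
  ring

lemma two_inner_le (hP : P.IsSymmetric) (hpos : ∀ w, 0 ≤ ⟪w, P w⟫) (u v : E) :
    2 * ⟪P u, v⟫ ≤ ⟪u, P u⟫ + ⟪v, P v⟫ := by
  have h := hpos (u - v)
  have h1 : ⟪P u, v⟫ = ⟪u, P v⟫ := hP u v
  have h2 : ⟪v, P u⟫ = ⟪u, P v⟫ := by rw [← hP, real_inner_comm]
  simp only [map_sub, inner_sub_left, inner_sub_right, h2] at h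
  linarith

lemma norm_sq_apply_le [FiniteDimensional ℝ E] (hP : P.IsSymmetric)
    (hpos : ∀ w, 0 ≤ ⟪w, P w⟫) :
    ∃ C : ℝ, ∀ u, ‖P u‖ ^ 2 ≤ C * ⟪u, P u⟫ := by
  set L := ‖LinearMap.toContinuousLinearMap P‖ with hL
  have hL0 : 0 ≤ L := norm_nonneg _
  refine ⟨L + 1, fun u => ?_⟩
  have h0 := hpos ((L + 1) • u - P u)
  have h1 : ⟪P u, P (P u)⟫ ≤ L * ‖P u‖ ^ 2 := by
    have h2 := (LinearMap.toContinuousLinearMap P).le_opNorm (P u)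
    have h3 := real_inner_le_norm (P u) (P (P u))
    simp only [LinearMap.coe_toContinuousLinearMap'] at h2
    nlinarith [norm_nonneg (P u)]
  have h2 : ⟪u, P (P u)⟫ = ‖P u‖ ^ 2 := by rw [← hP, real_inner_self_eq_norm_sq]
  have h3 : ⟪P u, P u⟫ = ‖P u‖ ^ 2 := real_inner_self_eq_norm_sq _
  simp only [map_sub, map_smul, inner_sub_left, inner_sub_right, real_inner_smul_left,
    real_inner_smul_right, h2, h3] at h0
  have h4 : 0 ≤ (L + 1) * ((L + 1) * ⟪u, P u⟫ - ‖P u‖ ^ 2) := by nlinarith [sq_nonneg ‖P u‖]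
  linarith [nonneg_of_mul_nonneg_right h4 (by linarith)]

lemma tendsto_apply_zero_of_inner [FiniteDimensional ℝ E] (hP : P.IsSymmetric)
    (hpos : ∀ w, 0 ≤ ⟪w, P w⟫) {u : ℕ → E}
    (hu : Tendsto (fun n => ⟪u n, P (u n)⟫) atTop (nhds 0)) :
    Tendsto (fun n => P (u n)) atTop (nhds 0) := by
  obtain ⟨C, hC⟩ := norm_sq_apply_le hP hpos
  have h1 : Tendsto (fun n => ‖P (u n)‖ ^ 2) atTop (nhds 0) :=
    squeeze_zero (fun n => sq_nonneg _) (fun n => hC (u n)) (by simpa using hu.const_mul C)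
  rw [tendsto_zero_iff_norm_tendsto_zero]
  simpa [Real.sqrt_sq] using h1.sqrt

end PosSemidef

lemma tendsto_zero_of_norm_sq {E : Type*} [SeminormedAddCommGroup E] {u : ℕ → E}
    (hu : Tendsto (fun n => ‖u n‖ ^ 2) atTop (nhds 0)) : Tendsto u atTop (nhds 0) := by
  rw [tendsto_zero_iff_norm_tendsto_zero]
  simpa [Real.sqrt_sq] using hu.sqrt

/-- A nonnegative sequence that decreases by `d n` up to a summable error `e n` converges,
and the decrements `d n` are summable. -/
lemma summable_and_tendsto_of_quasi_descent {a d e : ℕ → ℝ} (ha : ∀ n, 0 ≤ a n)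
    (hd : ∀ n, 0 ≤ d n) (he : Summable e) (he0 : ∀ n, 0 ≤ e n)
    (h : ∀ n, a (n + 1) + d n ≤ a n + e n) :
    Summable d ∧ ∃ l, Tendsto a atTop (nhds l) := by
  have hsum : ∀ n, a n + ∑ i ∈ Finset.range n, d i ≤ a 0 + ∑ i ∈ Finset.range n, e i := by
    intro n
    induction n with
    | zero => simp
    | succ k ih => rw [Finset.sum_range_succ, Finset.sum_range_succ]; linarith [h k]
  refine ⟨summable_of_sum_range_le (c := a 0 + ∑' i, e i) hd fun n => ?_, ?_⟩
  · linarith [ha n, hsum n, he.sum_le_tsum (Finset.range n) fun i _ => he0 i]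
  · have hanti : Antitone fun n => a n - ∑ i ∈ Finset.range n, e i := by
      refine antitone_nat_of_succ_le fun n => ?_
      rw [Finset.sum_range_succ]
      linarith [h n, hd n]
    have hbdd : BddBelow (Set.range fun n => a n - ∑ i ∈ Finset.range n, e i) := by
      refine ⟨-∑' i, e i, ?_⟩
      rintro _ ⟨n, rfl⟩
      have := he.sum_le_tsum (Finset.range n) fun i _ => he0 i
      simp only
      linarith [ha n]
    have h1 := tendsto_atTop_ciInf hanti hbdd
    refine ⟨_, (h1.add he.hasSum.tendsto_sum_nat).congr fun n => ?_⟩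
    simp

/-- The constraint residual `A* y + B* z - c`. -/
def primalResidual (A : X →ₗ[ℝ] Y) (B : X →ₗ[ℝ] Z) (c : X) (y : Y) (z : Z) : X :=
  LinearMap.adjoint A y + LinearMap.adjoint B z - c

/-- The Lyapunov function of the sPADMM relative to a reference point `(xb, yb, zb)`. -/
def energy (B : X →ₗ[ℝ] Z) (σ τ : ℝ) (S : Y →ₗ[ℝ] Y) (T : Z →ₗ[ℝ] Z)
    (xb : X) (yb : Y) (zb : Z) (x : X) (y : Y) (z : Z) : ℝ :=
  (τ * σ)⁻¹ * ‖x - xb‖ ^ 2 + ⟪y - yb, S (y - yb)⟫ + ⟪z - zb, T (z - zb)⟫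
    + σ * ‖LinearMap.adjoint B (z - zb)‖ ^ 2

lemma IsSPADMM.ne_top {f : Y → EReal} {g : Z → EReal} (hf : ∀ u, f u ≠ ⊥) (hg : ∀ u, g u ≠ ⊥)
    {A : X →ₗ[ℝ] Y} {B : X →ₗ[ℝ] Z} {c : X} {σ τ : ℝ} {S : Y →ₗ[ℝ] Y} {T : Z →ₗ[ℝ] Z}
    {x : ℕ → X} {y : ℕ → Y} {z : ℕ → Z} (h : IsSPADMM f g A B c σ τ S T x y z) (k : ℕ) :
    f (y k) ≠ ⊤ ∧ g (z k) ≠ ⊤ := by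
  obtain ⟨h0, h0', hy, hz, -⟩ := h
  induction k with
  | zero => exact ⟨h0, h0'⟩
  | succ k ih =>
    have hy1 : f (y (k + 1)) ≠ ⊤ := by
      intro htop
      have := hy k (y k)
      simp only [ysub, augL, htop] at this
      rw [EReal.top_add_of_ne_bot (hg _), EReal.top_add_coe, EReal.top_add_coe,
        EReal.top_add_coe, top_le_iff] at this
      exact EReal.add_ne_top (EReal.add_ne_top (EReal.add_ne_top (EReal.add_ne_top ih.1 ih.2)
        (EReal.coe_ne_top _)) (EReal.coe_ne_top _)) (EReal.coe_ne_top _) this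
    refine ⟨hy1, fun htop => ?_⟩
    have := hz k (z k)
    simp only [zsub, augL, htop] at this
    rw [EReal.add_top_of_ne_bot (hf _), EReal.top_add_coe, EReal.top_add_coe,
      EReal.top_add_coe, top_le_iff] at this
    exact EReal.add_ne_top (EReal.add_ne_top (EReal.add_ne_top (EReal.add_ne_top hy1 ih.2)
      (EReal.coe_ne_top _)) (EReal.coe_ne_top _)) (EReal.coe_ne_top _) this

lemma IsSPADMM.subgradient_y {f : Y → EReal} {g : Z → EReal}
    (hf : ProperConvexLsc f) (hg : ProperConvexLsc g)
    {A : X →ₗ[ℝ] Y} {B : X →ₗ[ℝ] Z} {c : X} {σ τ : ℝ} {S : Y →ₗ[ℝ] Y} {T : Z →ₗ[ℝ] Z}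
    (hS : S.IsSymmetric) {x : ℕ → X} {y : ℕ → Y} {z : ℕ → Z}
    (h : IsSPADMM f g A B c σ τ S T x y z) (k : ℕ) :
    -(A (x k + σ • primalResidual A B c (y (k + 1)) (z k)) + S (y (k + 1) - y k))
      ∈ subdiff f (y (k + 1)) := by
  have hfin := h.ne_top hf.2.1 hg.2.1
  obtain ⟨γ, hγ⟩ : ∃ γ : ℝ, g (z k) = γ :=
    ⟨(g (z k)).toReal, (EReal.coe_toReal (hfin k).2 (hg.2.1 _)).symm⟩
  have := subproblem_optimality hf A (LinearMap.adjoint B (z k) - c) (x k) σ γ hS (v := y k)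
    (hfin (k + 1)).1 (q := fun w => γ + ⟪x k, primalResidual A B c w (z k)⟫
      + σ / 2 * ‖primalResidual A B c w (z k)‖ ^ 2 + ⟪w - y k, S (w - y k)⟫ / 2)
    (fun w => by simp only [primalResidual, add_sub_assoc]) (fun w => by
      have := h.2.2.1 k w
      simp only [ysub, augL, hγ] at this
      simpa only [primalResidual, EReal.coe_add, add_assoc] using this)
  simpa only [primalResidual, add_sub_assoc] using this

lemma IsSPADMM.subgradient_z {f : Y → EReal} {g : Z → EReal}
    (hf : ProperConvexLsc f) (hg : ProperConvexLsc g)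
    {A : X →ₗ[ℝ] Y} {B : X →ₗ[ℝ] Z} {c : X} {σ τ : ℝ} {S : Y →ₗ[ℝ] Y} {T : Z →ₗ[ℝ] Z}
    (hT : T.IsSymmetric) {x : ℕ → X} {y : ℕ → Y} {z : ℕ → Z}
    (h : IsSPADMM f g A B c σ τ S T x y z) (k : ℕ) :
    -(B (x k + σ • primalResidual A B c (y (k + 1)) (z (k + 1))) + T (z (k + 1) - z k))
      ∈ subdiff g (z (k + 1)) := by
  have hfin := h.ne_top hf.2.1 hg.2.1
  obtain ⟨γ, hγ⟩ : ∃ γ : ℝ, f (y (k + 1)) = γ :=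
    ⟨(f (y (k + 1))).toReal, (EReal.coe_toReal (hfin (k + 1)).1 (hf.2.1 _)).symm⟩
  have hr : ∀ w, LinearMap.adjoint B w + (LinearMap.adjoint A (y (k + 1)) - c)
      = primalResidual A B c (y (k + 1)) w := fun w => by rw [primalResidual]; abel
  have := subproblem_optimality hg B (LinearMap.adjoint A (y (k + 1)) - c) (x k) σ γ hT
    (v := z k) (hfin (k + 1)).2 (q := fun w => γ + ⟪x k, primalResidual A B c (y (k + 1)) w⟫
      + σ / 2 * ‖primalResidual A B c (y (k + 1)) w‖ ^ 2 + ⟪w - z k, T (w - z k)⟫ / 2)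
    (fun w => by simp only [hr]) (fun w => by
      have := h.2.2.2.1 k w
      simp only [zsub, augL, hγ, add_comm (γ : EReal)] at this
      simpa only [primalResidual, EReal.coe_add, add_assoc] using this)
  rwa [hr] at this

lemma multiplier_step_identity {E : Type*} [NormedAddCommGroup E] [InnerProductSpace ℝ E]
    {σ τ : ℝ} (hσ : 0 < σ) (hτ : 0 < τ) (ξ α β β' : E) :
    (τ * σ)⁻¹ * ‖ξ + (τ * σ) • (α + β')‖ ^ 2 + σ * ‖β'‖ ^ 2 + σ * ‖β' - β‖ ^ 2
      + (2 - τ) * σ * ‖α + β'‖ ^ 2 - 2 * σ * ⟪β' - β, α + β'⟫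
    = (τ * σ)⁻¹ * ‖ξ‖ ^ 2 + σ * ‖β‖ ^ 2
      + 2 * (⟪ξ + σ • (α + β), α⟫ + ⟪ξ + σ • (α + β'), β'⟫) := by
  have h1 : (τ * σ)⁻¹ * ‖ξ + (τ * σ) • (α + β')‖ ^ 2
      = (τ * σ)⁻¹ * ‖ξ‖ ^ 2 + 2 * ⟪ξ, α + β'⟫ + τ * σ * ‖α + β'‖ ^ 2 := by
    rw [norm_add_sq_real, norm_smul, mul_pow, Real.norm_eq_abs, sq_abs, real_inner_smul_right]
    field_simp
  rw [h1]
  have h2 : ⟪β, α⟫ = ⟪α, β⟫ := real_inner_comm _ _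
  have h3 : ⟪β', α⟫ = ⟪α, β'⟫ := real_inner_comm _ _
  have h4 : ⟪β', β⟫ = ⟪β, β'⟫ := real_inner_comm _ _
  simp only [← real_inner_self_eq_norm_sq, inner_add_left, inner_add_right, inner_sub_left,
    inner_sub_right, real_inner_smul_left, h2, h3, h4]
  ring

lemma IsSPADMM.energy_descent {f : Y → EReal} {g : Z → EReal}
    (hf : ProperConvexLsc f) (hg : ProperConvexLsc g)
    {A : X →ₗ[ℝ] Y} {B : X →ₗ[ℝ] Z} {c : X} {σ τ : ℝ} (hσ : 0 < σ) (hτ : 0 < τ)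
    {S : Y →ₗ[ℝ] Y} {T : Z →ₗ[ℝ] Z} (hS : S.IsSymmetric) (hT : T.IsSymmetric)
    {Sf : Y →ₗ[ℝ] Y} {Sg : Z →ₗ[ℝ] Z} (hSf : SubMono f Sf) (hSg : SubMono g Sg)
    {xb : X} {yb : Y} {zb : Z} (hkkt : IsKKT f g A B c xb yb zb)
    {x : ℕ → X} {y : ℕ → Y} {z : ℕ → Z} (h : IsSPADMM f g A B c σ τ S T x y z) (k : ℕ) :
    energy B σ τ S T xb yb zb (x (k + 1)) (y (k + 1)) (z (k + 1))
      + (2 * ⟪y (k + 1) - yb, Sf (y (k + 1) - yb)⟫ + 2 * ⟪z (k + 1) - zb, Sg (z (k + 1) - zb)⟫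
        + ⟪y (k + 1) - y k, S (y (k + 1) - y k)⟫ + ⟪z (k + 1) - z k, T (z (k + 1) - z k)⟫
        + σ * ‖LinearMap.adjoint B (z (k + 1) - z k)‖ ^ 2)
      + (2 - τ) * σ * ‖primalResidual A B c (y (k + 1)) (z (k + 1))‖ ^ 2
      - 2 * σ * ⟪LinearMap.adjoint B (z (k + 1) - z k), primalResidual A B c (y (k + 1)) (z (k + 1))⟫
    ≤ energy B σ τ S T xb yb zb (x k) (y k) (z k) := by
  have h1 := hSf _ _ _ _ (h.subgradient_y hf hg hS k) hkkt.1
  have h2 := hSg _ _ _ _ (h.subgradient_z hf hg hT k) hkkt.2.1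
  have hr : ∀ v w, primalResidual A B c v w
      = LinearMap.adjoint A (v - yb) + LinearMap.adjoint B (w - zb) := fun v w => by
    rw [primalResidual, ← hkkt.2.2, map_sub, map_sub]; abel
  have h3 := two_inner_sub_eq hS (y (k + 1) - yb) (y k - yb)
  have h4 := two_inner_sub_eq hT (z (k + 1) - zb) (z k - zb)
  rw [sub_sub_sub_cancel_right] at h3 h4
  have h5 : -(A (x k + σ • primalResidual A B c (y (k + 1)) (z k)) + S (y (k + 1) - y k)) - -(A xb)
      = -(A (x k - xb + σ • primalResidual A B c (y (k + 1)) (z k))) - S (y (k + 1) - y k) := by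
    simp only [map_add, map_sub]; abel
  have h6 : -(B (x k + σ • primalResidual A B c (y (k + 1)) (z (k + 1))) + T (z (k + 1) - z k))
        - -(B xb)
      = -(B (x k - xb + σ • primalResidual A B c (y (k + 1)) (z (k + 1)))) - T (z (k + 1) - z k) := by
    simp only [map_add, map_sub]; abel
  rw [h5, inner_sub_left (-A _), inner_neg_left, ← LinearMap.adjoint_inner_right, hr] at h1
  rw [h6, inner_sub_left (-B _), inner_neg_left, ← LinearMap.adjoint_inner_right, hr] at h2
  have h7 := multiplier_step_identity hσ hτ (x k - xb) (LinearMap.adjoint A (y (k + 1) - yb))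
    (LinearMap.adjoint B (z k - zb)) (LinearMap.adjoint B (z (k + 1) - zb))
  have h8 : x (k + 1) - xb = x k - xb + (τ * σ) • primalResidual A B c (y (k + 1)) (z (k + 1)) := by
    rw [h.2.2.2.2 k, primalResidual]; abel
  have h9 : LinearMap.adjoint B (z (k + 1) - z k)
      = LinearMap.adjoint B (z (k + 1) - zb) - LinearMap.adjoint B (z k - zb) := by
    rw [← map_sub, sub_sub_sub_cancel_right]
  rw [energy, energy, h8, h9, hr]
  linarith

/-- Monotonicity of `∂g` between consecutive iterates controls the cross term in
`IsSPADMM.energy_descent`. -/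
lemma IsSPADMM.cross_term_le {f : Y → EReal} {g : Z → EReal}
    (hf : ProperConvexLsc f) (hg : ProperConvexLsc g)
    {A : X →ₗ[ℝ] Y} {B : X →ₗ[ℝ] Z} {c : X} {σ τ : ℝ}
    {S : Y →ₗ[ℝ] Y} {T : Z →ₗ[ℝ] Z} (hT : T.IsSymmetric) (hTpos : ∀ w, 0 ≤ ⟪w, T w⟫)
    {Sg : Z →ₗ[ℝ] Z} (hSgpos : ∀ w, 0 ≤ ⟪w, Sg w⟫) (hSg : SubMono g Sg)
    {x : ℕ → X} {y : ℕ → Y} {z : ℕ → Z} (h : IsSPADMM f g A B c σ τ S T x y z) (k : ℕ) :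
    2 * σ * ⟪LinearMap.adjoint B (z (k + 2) - z (k + 1)),
        primalResidual A B c (y (k + 2)) (z (k + 2))⟫
      + ⟪z (k + 2) - z (k + 1), T (z (k + 2) - z (k + 1))⟫
    ≤ 2 * ((1 - τ) * σ) * ⟪LinearMap.adjoint B (z (k + 2) - z (k + 1)),
        primalResidual A B c (y (k + 1)) (z (k + 1))⟫
      + ⟪z (k + 1) - z k, T (z (k + 1) - z k)⟫ := by
  have h1 := (hSgpos _).trans
    (hSg _ _ _ _ (h.subgradient_z hf hg hT (k + 1)) (h.subgradient_z hf hg hT k))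
  have hx : x (k + 1) = x k + (τ * σ) • primalResidual A B c (y (k + 1)) (z (k + 1)) :=
    h.2.2.2.2 k
  have h2 := two_inner_le hT hTpos (z (k + 1) - z k) (z (k + 2) - z (k + 1))
  have h3 : ⟪T (z (k + 2) - z (k + 1)), z (k + 2) - z (k + 1)⟫
      = ⟪z (k + 2) - z (k + 1), T (z (k + 2) - z (k + 1))⟫ := hT _ _
  rw [hx] at h1
  simp only [add_assoc, Nat.reduceAdd] at h1 h2 h3 ⊢
  generalize primalResidual A B c (y (k + 1)) (z (k + 1)) = r at *
  generalize primalResidual A B c (y (k + 2)) (z (k + 2)) = r' at *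
  have h4 : ∀ a, ⟪B a, z (k + 2) - z (k + 1)⟫
      = ⟪LinearMap.adjoint B (z (k + 2) - z (k + 1)), a⟫ := fun a => by
    rw [LinearMap.adjoint_inner_left, real_inner_comm]
  generalize z (k + 2) - z (k + 1) = d at *
  generalize z (k + 1) - z k = d' at *
  simp only [inner_sub_left, inner_neg_left, inner_add_left, map_add, map_smul,
    real_inner_smul_left, h4, h3] at h1
  linarith

lemma energy_nonneg {E : Type*} [NormedAddCommGroup E] [InnerProductSpace ℝ E]
    (B : X →ₗ[ℝ] Z) {σ τ : ℝ} (hσ : 0 < σ) (hτ : 0 < τ)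
    {S : E →ₗ[ℝ] E} {T : Z →ₗ[ℝ] Z} (hS : ∀ w, 0 ≤ ⟪w, S w⟫) (hT : ∀ w, 0 ≤ ⟪w, T w⟫)
    (xb : X) (yb : E) (zb : Z) (x : X) (y : E) (z : Z) :
    0 ≤ energy B σ τ S T xb yb zb x y z := by
  have := hS (y - yb)
  have := hT (z - zb)
  rw [energy]
  positivity

/-- Weighted Young inequality. -/
lemma two_mul_inner_le {E : Type*} [NormedAddCommGroup E] [InnerProductSpace ℝ E]
    (u v : E) {a : ℝ} (ha : 0 < a) (b : ℝ) :
    2 * b * ⟪u, v⟫ ≤ a * ‖v‖ ^ 2 + b ^ 2 / a * ‖u‖ ^ 2 := by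
  have h := sq_nonneg ‖(b / a) • u - v‖
  rw [norm_sub_sq_real, norm_smul, mul_pow, Real.norm_eq_abs, sq_abs, real_inner_smul_left] at h
  have h2 : 0 ≤ a * ((b / a) ^ 2 * ‖u‖ ^ 2 - 2 * (b / a * ⟪u, v⟫) + ‖v‖ ^ 2) := by positivity
  have h3 : a * ((b / a) ^ 2 * ‖u‖ ^ 2 - 2 * (b / a * ⟪u, v⟫) + ‖v‖ ^ 2)
      = b ^ 2 / a * ‖u‖ ^ 2 - 2 * b * ⟪u, v⟫ + a * ‖v‖ ^ 2 := by
    field_simp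
  linarith

lemma IsSPADMM.summable_residual {f : Y → EReal} {g : Z → EReal}
    (hf : ProperConvexLsc f) (hg : ProperConvexLsc g)
    {A : X →ₗ[ℝ] Y} {B : X →ₗ[ℝ] Z} {c : X} {σ τ : ℝ} (hσ : 0 < σ) (hτ : 0 < τ)
    {S : Y →ₗ[ℝ] Y} {T : Z →ₗ[ℝ] Z} (hS : S.IsSymmetric) (hT : T.IsSymmetric)
    (hSpos : ∀ w, 0 ≤ ⟪w, S w⟫) (hTpos : ∀ w, 0 ≤ ⟪w, T w⟫)
    {Sf : Y →ₗ[ℝ] Y} {Sg : Z →ₗ[ℝ] Z} (hSf : SubMono f Sf) (hSg : SubMono g Sg)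
    (hSfpos : ∀ w, 0 ≤ ⟪w, Sf w⟫) (hSgpos : ∀ w, 0 ≤ ⟪w, Sg w⟫)
    {xb : X} {yb : Y} {zb : Z} (hkkt : IsKKT f g A B c xb yb zb)
    {x : ℕ → X} {y : ℕ → Y} {z : ℕ → Z} (h : IsSPADMM f g A B c σ τ S T x y z)
    (hC : CondC τ x) :
    Summable fun k => ‖primalResidual A B c (y (k + 1)) (z (k + 1))‖ ^ 2 := by
  rcases hC with ⟨-, hlt⟩ | ⟨-, hsum⟩
  · have hgold : (1 - τ) ^ 2 < 2 - τ := by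
      have h5 : Real.sqrt 5 ^ 2 = 5 := Real.sq_sqrt (by norm_num)
      have h1 : 1 ≤ Real.sqrt 5 := Real.one_le_sqrt.2 (by norm_num)
      have hprod : 0 < (τ - (1 - Real.sqrt 5) / 2) * ((1 + Real.sqrt 5) / 2 - τ) :=
        mul_pos (by linarith) (by linarith)
      linarith
    obtain ⟨a, ha1, ha2⟩ := exists_between hgold
    have ha : 0 < a := (sq_nonneg _).trans_lt ha1
    have hle : (1 - τ) ^ 2 / a ≤ 1 := (div_le_one ha).2 ha1.le
    have hgap : 0 < (2 - τ - a) * σ := mul_pos (by linarith) hσ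
    obtain ⟨hsum, -⟩ := summable_and_tendsto_of_quasi_descent
      (a := fun k => energy B σ τ S T xb yb zb (x (k + 1)) (y (k + 1)) (z (k + 1))
        + ⟪z (k + 1) - z k, T (z (k + 1) - z k)⟫
        + σ * a * ‖primalResidual A B c (y (k + 1)) (z (k + 1))‖ ^ 2)
      (d := fun k => (2 - τ - a) * σ * ‖primalResidual A B c (y (k + 2)) (z (k + 2))‖ ^ 2)
      (e := fun _ => 0)
      (fun k => by
        have := energy_nonneg B hσ hτ hSpos hTpos xb yb zb (x (k + 1)) (y (k + 1)) (z (k + 1))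
        have := hTpos (z (k + 1) - z k)
        positivity)
      (fun k => by positivity) summable_zero (fun _ => le_rfl)
      (fun k => by
        have h1 := h.energy_descent hf hg hσ hτ hS hT hSf hSg hkkt (k + 1)
        have h2 := h.cross_term_le hf hg hT hTpos hSgpos hSg k
        have h3 := mul_le_mul_of_nonneg_left (two_mul_inner_le
          (LinearMap.adjoint B (z (k + 2) - z (k + 1)))
          (primalResidual A B c (y (k + 1)) (z (k + 1))) ha (1 - τ)) hσ.le
        have h4 := mul_le_mul_of_nonneg_left (mul_le_mul_of_nonneg_right hle
          (sq_nonneg ‖LinearMap.adjoint B (z (k + 2) - z (k + 1))‖)) hσ.le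
        have h5 := hSfpos (y (k + 2) - yb)
        have h6 := hSgpos (z (k + 2) - zb)
        have h7 := hSpos (y (k + 2) - y (k + 1))
        have h8 := hTpos (z (k + 2) - z (k + 1))
        simp only [add_assoc, Nat.reduceAdd] at h1 h2 h3 h4 ⊢
        linarith)
    rw [summable_mul_left_iff hgap.ne'] at hsum
    exact (summable_nat_add_iff 1).1 hsum
  · have hpos : 0 < (τ * σ) ^ 2 := by positivity
    refine (summable_mul_left_iff hpos.ne').1 (hsum.congr fun k => ?_)
    rw [h.2.2.2.2 k, add_sub_cancel_left, norm_smul, mul_pow, Real.norm_eq_abs, sq_abs, primalResidual]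

/-- Relative to any KKT point the energy converges and the successive decrements vanish. -/
lemma IsSPADMM.energy_convergence {f : Y → EReal} {g : Z → EReal}
    (hf : ProperConvexLsc f) (hg : ProperConvexLsc g)
    {A : X →ₗ[ℝ] Y} {B : X →ₗ[ℝ] Z} {c : X} {σ τ : ℝ} (hσ : 0 < σ) (hτ : 0 < τ)
    {S : Y →ₗ[ℝ] Y} {T : Z →ₗ[ℝ] Z} (hS : S.IsSymmetric) (hT : T.IsSymmetric)
    (hSpos : ∀ w, 0 ≤ ⟪w, S w⟫) (hTpos : ∀ w, 0 ≤ ⟪w, T w⟫)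
    {Sf : Y →ₗ[ℝ] Y} {Sg : Z →ₗ[ℝ] Z} (hSf : SubMono f Sf) (hSg : SubMono g Sg)
    (hSfpos : ∀ w, 0 ≤ ⟪w, Sf w⟫) (hSgpos : ∀ w, 0 ≤ ⟪w, Sg w⟫)
    {xb : X} {yb : Y} {zb : Z} (hkkt : IsKKT f g A B c xb yb zb)
    {x : ℕ → X} {y : ℕ → Y} {z : ℕ → Z} (h : IsSPADMM f g A B c σ τ S T x y z)
    (hr : Summable fun k => ‖primalResidual A B c (y (k + 1)) (z (k + 1))‖ ^ 2) :
    (∃ l, Tendsto (fun k => energy B σ τ S T xb yb zb (x k) (y k) (z k)) atTop (nhds l)) ∧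
      Tendsto (fun k => ⟪y (k + 1) - yb, Sf (y (k + 1) - yb)⟫) atTop (nhds 0) ∧
      Tendsto (fun k => ⟪z (k + 1) - zb, Sg (z (k + 1) - zb)⟫) atTop (nhds 0) ∧
      Tendsto (fun k => ⟪y (k + 1) - y k, S (y (k + 1) - y k)⟫) atTop (nhds 0) ∧
      Tendsto (fun k => ⟪z (k + 1) - z k, T (z (k + 1) - z k)⟫) atTop (nhds 0) ∧
      Tendsto (fun k => ‖LinearMap.adjoint B (z (k + 1) - z k)‖ ^ 2) atTop (nhds 0) := by
  have h5 := fun k => hSfpos (y (k + 1) - yb)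
  have h6 := fun k => hSgpos (z (k + 1) - zb)
  have h7 := fun k => hSpos (y (k + 1) - y k)
  have h8 := fun k => hTpos (z (k + 1) - z k)
  have h9 := fun k => mul_nonneg hσ.le (sq_nonneg ‖LinearMap.adjoint B (z (k + 1) - z k)‖)
  obtain ⟨hsum, hlim⟩ := summable_and_tendsto_of_quasi_descent
    (a := fun k => energy B σ τ S T xb yb zb (x k) (y k) (z k))
    (d := fun k => 2 * ⟪y (k + 1) - yb, Sf (y (k + 1) - yb)⟫
      + 2 * ⟪z (k + 1) - zb, Sg (z (k + 1) - zb)⟫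
      + ⟪y (k + 1) - y k, S (y (k + 1) - y k)⟫ + ⟪z (k + 1) - z k, T (z (k + 1) - z k)⟫
      + σ * ‖LinearMap.adjoint B (z (k + 1) - z k)‖ ^ 2 / 2)
    (e := fun k => τ * σ * ‖primalResidual A B c (y (k + 1)) (z (k + 1))‖ ^ 2)
    (fun k => energy_nonneg B hσ hτ hSpos hTpos xb yb zb (x k) (y k) (z k))
    (fun k => by linarith [h5 k, h6 k, h7 k, h8 k, h9 k]) (hr.mul_left _)
    (fun k => by positivity)
    (fun k => by
      have h1 := h.energy_descent hf hg hσ hτ hS hT hSf hSg hkkt k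
      have h2 := mul_le_mul_of_nonneg_left (two_mul_inner_le
        (LinearMap.adjoint B (z (k + 1) - z k))
        (primalResidual A B c (y (k + 1)) (z (k + 1))) two_pos 1) hσ.le
      linarith)
  have hd := hsum.tendsto_atTop_zero
  refine ⟨hlim, ?_, ?_, ?_, ?_, ?_⟩
  · exact squeeze_zero h5 (fun k => by linarith [h5 k, h6 k, h7 k, h8 k, h9 k]) hd
  · exact squeeze_zero h6 (fun k => by linarith [h5 k, h6 k, h7 k, h8 k, h9 k]) hd
  · exact squeeze_zero h7 (fun k => by linarith [h5 k, h6 k, h7 k, h8 k, h9 k]) hd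
  · exact squeeze_zero h8 (fun k => by linarith [h5 k, h6 k, h7 k, h8 k, h9 k]) hd
  · have h10 := hd.const_mul (2 / σ)
    rw [mul_zero] at h10
    refine squeeze_zero (fun k => sq_nonneg _) (fun k => ?_) h10
    rw [div_mul_eq_mul_div, le_div_iff₀ hσ]
    linarith [h5 k, h6 k, h7 k, h8 k, h9 k]

/-- If the energy relative to `(xb, yb, zb)` converges and a subsequence of the iterates tends to
`(xb, yb, zb)`, then the energy tends to zero. -/
lemma tendsto_energy_zero (B : X →ₗ[ℝ] Z) (σ τ : ℝ) (S : Y →ₗ[ℝ] Y) (T : Z →ₗ[ℝ] Z)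
    {xb : X} {yb : Y} {zb : Z} {x : ℕ → X} {y : ℕ → Y} {z : ℕ → Z} {l : ℝ}
    (hl : Tendsto (fun k => energy B σ τ S T xb yb zb (x k) (y k) (z k)) atTop (nhds l))
    {φ : ℕ → ℕ} (hφ : Tendsto φ atTop atTop)
    (hlim : Tendsto (fun k => (x (φ k), y (φ k), z (φ k))) atTop (nhds (xb, yb, zb))) :
    Tendsto (fun k => energy B σ τ S T xb yb zb (x k) (y k) (z k)) atTop (nhds 0) := by
  have hcont : Continuous fun p : X × Y × Z =>
      energy B σ τ S T xb yb zb p.1 p.2.1 p.2.2 := by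
    have hBadj : Continuous (LinearMap.adjoint B) := LinearMap.continuous_of_finiteDimensional _
    have hS : Continuous S := S.continuous_of_finiteDimensional
    have hT : Continuous T := T.continuous_of_finiteDimensional
    unfold energy
    fun_prop
  have hlφ : Tendsto (fun k => energy B σ τ S T xb yb zb (x (φ k)) (y (φ k)) (z (φ k)))
      atTop (nhds (energy B σ τ S T xb yb zb xb yb zb)) := by
    have := (hcont.tendsto (xb, yb, zb)).comp hlim
    simpa only [Function.comp_def] using this
  have hself : energy B σ τ S T xb yb zb xb yb zb = 0 := by simp [energy]
  rwa [tendsto_nhds_unique (hl.comp hφ) hlφ, hself] at hl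

/-- Every subsequential limit of the iterates is a KKT point. -/
lemma IsSPADMM.isKKT_of_tendsto_subseq {f : Y → EReal} {g : Z → EReal}
    (hf : ProperConvexLsc f) (hg : ProperConvexLsc g)
    {A : X →ₗ[ℝ] Y} {B : X →ₗ[ℝ] Z} {c : X} {σ τ : ℝ} (hσ : 0 < σ) (hτ : 0 < τ)
    {S : Y →ₗ[ℝ] Y} {T : Z →ₗ[ℝ] Z} (hS : S.IsSymmetric) (hT : T.IsSymmetric)
    (hSpos : ∀ w, 0 ≤ ⟪w, S w⟫) (hTpos : ∀ w, 0 ≤ ⟪w, T w⟫)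
    {Sf : Y →ₗ[ℝ] Y} {Sg : Z →ₗ[ℝ] Z} (hSf : SubMono f Sf) (hSg : SubMono g Sg)
    (hSfpos : ∀ w, 0 ≤ ⟪w, Sf w⟫) (hSgpos : ∀ w, 0 ≤ ⟪w, Sg w⟫)
    {xb : X} {yb : Y} {zb : Z} (hkkt : IsKKT f g A B c xb yb zb)
    {x : ℕ → X} {y : ℕ → Y} {z : ℕ → Z} (h : IsSPADMM f g A B c σ τ S T x y z)
    (hr : Summable fun k => ‖primalResidual A B c (y (k + 1)) (z (k + 1))‖ ^ 2)
    {xinf : X} {yinf : Y} {zinf : Z} {φ : ℕ → ℕ} (hφ : StrictMono φ)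
    (hlim : Tendsto (fun k => (x (φ k), y (φ k), z (φ k))) atTop (nhds (xinf, yinf, zinf))) :
    IsKKT f g A B c xinf yinf zinf := by
  have hr0 : Tendsto (fun k => primalResidual A B c (y (k + 1)) (z (k + 1))) atTop (nhds 0) :=
    tendsto_zero_of_norm_sq hr.tendsto_atTop_zero
  obtain ⟨-, -, -, hSΔ, hTΔ, hBΔ⟩ := h.energy_convergence hf hg hσ hτ hS hT hSpos hTpos
    hSf hSg hSfpos hSgpos hkkt hr
  replace hSΔ := tendsto_apply_zero_of_inner hS hSpos hSΔ
  replace hTΔ := tendsto_apply_zero_of_inner hT hTpos hTΔ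
  replace hBΔ := tendsto_zero_of_norm_sq hBΔ
  have hA : Continuous A := A.continuous_of_finiteDimensional
  have hB : Continuous B := B.continuous_of_finiteDimensional
  have hAadj : Continuous (LinearMap.adjoint A) := LinearMap.continuous_of_finiteDimensional _
  have hBadj : Continuous (LinearMap.adjoint B) := LinearMap.continuous_of_finiteDimensional _
  -- Along `ψ`, the indices `ψ k + 1` run through the convergent subsequence.
  obtain ⟨ψ, hψ, hψφ⟩ : ∃ ψ : ℕ → ℕ, Tendsto ψ atTop atTop ∧ ∀ k, ψ k + 1 = φ (k + 1) := by
    have hψφ : ∀ k, φ (k + 1) - 1 + 1 = φ (k + 1) := fun k =>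
      Nat.sub_add_cancel ((Nat.succ_pos k).trans_le (hφ.le_apply))
    refine ⟨fun k => φ (k + 1) - 1, tendsto_atTop_mono (fun k => ?_) tendsto_id, hψφ⟩
    have := hφ.le_apply (x := k + 1)
    simp only [id]
    omega
  have hlimψ : Tendsto (fun k => (x (ψ k + 1), y (ψ k + 1), z (ψ k + 1))) atTop
      (nhds (xinf, yinf, zinf)) := by
    simp only [hψφ]
    exact hlim.comp (tendsto_add_atTop_nat 1)
  have hx1 : Tendsto (fun k => x (ψ k + 1)) atTop (nhds xinf) := hlimψ.fst_nhds
  have hy1 : Tendsto (fun k => y (ψ k + 1)) atTop (nhds yinf) := hlimψ.snd_nhds.fst_nhds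
  have hz1 : Tendsto (fun k => z (ψ k + 1)) atTop (nhds zinf) := hlimψ.snd_nhds.snd_nhds
  have hx0 : Tendsto (fun k => x (ψ k)) atTop (nhds xinf) := by
    have := hx1.sub ((hr0.comp hψ).const_smul (τ * σ))
    rw [smul_zero, sub_zero] at this
    refine this.congr fun k => ?_
    rw [h.2.2.2.2 (ψ k)]
    exact add_sub_cancel_right _ _
  have hr1 : Tendsto (fun k => primalResidual A B c (y (k + 1)) (z k)) atTop (nhds 0) := by
    have := hr0.sub hBΔ
    rw [sub_zero] at this
    refine this.congr fun k => ?_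
    rw [primalResidual, primalResidual, map_sub]
    abel
  refine ⟨subdiff_closed hf.2.1 hf.2.2.2 hy1 ?_
      (Eventually.of_forall fun k => h.subgradient_y hf hg hS (ψ k)),
    subdiff_closed hg.2.1 hg.2.2.2 hz1 ?_
      (Eventually.of_forall fun k => h.subgradient_z hf hg hT (ψ k)), ?_⟩
  · have h1 := (hA.tendsto _).comp (hx0.add ((hr1.comp hψ).const_smul σ))
    simpa using (h1.add (hSΔ.comp hψ)).neg
  · have h1 := (hB.tendsto _).comp (hx0.add ((hr0.comp hψ).const_smul σ))
    simpa using (h1.add (hTΔ.comp hψ)).neg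
  · have h1 : Tendsto (fun k => primalResidual A B c (y (ψ k + 1)) (z (ψ k + 1))) atTop
        (nhds (primalResidual A B c yinf zinf)) :=
      (((hAadj.tendsto _).comp hy1).add ((hBadj.tendsto _).comp hz1)).sub_const c
    exact sub_eq_zero.1 (tendsto_nhds_unique h1 (hr0.comp hψ))

/-- **Theorem 1(c).**  If the KKT system has a solution and Condition (C) holds, then any
accumulation point `(x^∞, y^∞, z^∞)` of `{(x^k, y^k, z^k)}` solves the KKT system, and for
any such accumulation point `A*y^k → A*y^∞`, `(Σ_f + S)y^k → (Σ_f + S)y^∞`,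
`B*z^k → B*z^∞` and `(Σ_g + T)z^k → (Σ_g + T)z^∞` along the whole sequence. -/
theorem stmt_18
    (f : Y → EReal) (g : Z → EReal)
    (hf : ProperConvexLsc f) (hg : ProperConvexLsc g)
    (A : X →ₗ[ℝ] Y) (B : X →ₗ[ℝ] Z) (c : X)
    (σ τ : ℝ) (hσ : 0 < σ) (hτ : 0 < τ)
    (S : Y →ₗ[ℝ] Y) (hSsym : S.IsSymmetric) (hSpsd : ∀ w : Y, 0 ≤ ⟪w, S w⟫)
    (T : Z →ₗ[ℝ] Z) (hTsym : T.IsSymmetric) (hTpsd : ∀ w : Z, 0 ≤ ⟪w, T w⟫)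
    (Sf : Y →ₗ[ℝ] Y) (hSfsym : Sf.IsSymmetric) (hSfpsd : ∀ w : Y, 0 ≤ ⟪w, Sf w⟫)
    (hSfmono : SubMono f Sf)
    (Sg : Z →ₗ[ℝ] Z) (hSgsym : Sg.IsSymmetric) (hSgpsd : ∀ w : Z, 0 ≤ ⟪w, Sg w⟫)
    (hSgmono : SubMono g Sg)
    (xb : X) (yb : Y) (zb : Z) (hkkt : IsKKT f g A B c xb yb zb)
    (x : ℕ → X) (y : ℕ → Y) (z : ℕ → Z)
    (hseq : IsSPADMM f g A B c σ τ S T x y z)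
    (hC : CondC τ x) :
    ∀ xinf : X, ∀ yinf : Y, ∀ zinf : Z,
      (∃ φ : ℕ → ℕ, StrictMono φ ∧
        Tendsto (fun k : ℕ => (x (φ k), y (φ k), z (φ k))) atTop (nhds (xinf, yinf, zinf))) →
      IsKKT f g A B c xinf yinf zinf ∧
      Tendsto (fun k : ℕ => (LinearMap.adjoint A) (y k)) atTop
        (nhds ((LinearMap.adjoint A) yinf)) ∧
      Tendsto (fun k : ℕ => (Sf + S) (y k)) atTop (nhds ((Sf + S) yinf)) ∧
      Tendsto (fun k : ℕ => (LinearMap.adjoint B) (z k)) atTop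
        (nhds ((LinearMap.adjoint B) zinf)) ∧
      Tendsto (fun k : ℕ => (Sg + T) (z k)) atTop (nhds ((Sg + T) zinf)) := by
  rintro xinf yinf zinf ⟨φ, hφ, hlim⟩
  have hr := hseq.summable_residual hf hg hσ hτ hSsym hTsym hSpsd hTpsd hSfmono hSgmono
    hSfpsd hSgpsd hkkt hC
  have hkktinf := hseq.isKKT_of_tendsto_subseq hf hg hσ hτ hSsym hTsym hSpsd hTpsd hSfmono hSgmono
    hSfpsd hSgpsd hkkt hr hφ hlim
  have hr0 : Tendsto (fun k => primalResidual A B c (y (k + 1)) (z (k + 1))) atTop (nhds 0) :=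
    tendsto_zero_of_norm_sq hr.tendsto_atTop_zero
  obtain ⟨⟨l, hl⟩, hSf, hSg, -, -, -⟩ := hseq.energy_convergence hf hg hσ hτ hSsym hTsym hSpsd
    hTpsd hSfmono hSgmono hSfpsd hSgpsd hkktinf hr
  replace hl := tendsto_energy_zero B σ τ S T hl hφ.tendsto_atTop hlim
  have hSpos := fun k => hSpsd (y k - yinf)
  have hTpos := fun k => hTpsd (z k - zinf)
  have hxpos : ∀ k, 0 ≤ (τ * σ)⁻¹ * ‖x k - xinf‖ ^ 2 := fun k => by positivity
  have hBpos : ∀ k, 0 ≤ σ * ‖LinearMap.adjoint B (z k - zinf)‖ ^ 2 := fun k => by positivity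
  have hSy : Tendsto (fun k => S (y k - yinf)) atTop (nhds 0) :=
    tendsto_apply_zero_of_inner hSsym hSpsd (squeeze_zero hSpos
      (fun k => by rw [energy]; linarith [hSpos k, hTpos k, hxpos k, hBpos k]) hl)
  have hTz : Tendsto (fun k => T (z k - zinf)) atTop (nhds 0) :=
    tendsto_apply_zero_of_inner hTsym hTpsd (squeeze_zero hTpos
      (fun k => by rw [energy]; linarith [hSpos k, hTpos k, hxpos k, hBpos k]) hl)
  have hBz : Tendsto (fun k => LinearMap.adjoint B (z k - zinf)) atTop (nhds 0) := by
    have h1 := (squeeze_zero hBpos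
      (fun k => by rw [energy]; linarith [hSpos k, hTpos k, hxpos k, hBpos k]) hl).const_mul σ⁻¹
    exact tendsto_zero_of_norm_sq (by simpa [hσ.ne'] using h1)
  have hSfy : Tendsto (fun k => Sf (y k - yinf)) atTop (nhds 0) :=
    (tendsto_add_atTop_iff_nat 1).1 (tendsto_apply_zero_of_inner hSfsym hSfpsd hSf)
  have hSgz : Tendsto (fun k => Sg (z k - zinf)) atTop (nhds 0) :=
    (tendsto_add_atTop_iff_nat 1).1 (tendsto_apply_zero_of_inner hSgsym hSgpsd hSg)
  have hAy : Tendsto (fun k => LinearMap.adjoint A (y k - yinf)) atTop (nhds 0) := by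
    refine (tendsto_add_atTop_iff_nat 1).1 ?_
    have := hr0.sub (hBz.comp (tendsto_add_atTop_nat 1))
    rw [sub_zero] at this
    refine this.congr fun k => ?_
    simp only [Function.comp, primalResidual, ← hkktinf.2.2, map_sub]
    abel
  refine ⟨hkktinf, ?_, ?_, ?_, ?_⟩ <;> rw [← tendsto_sub_nhds_zero_iff] <;>
    simp only [← map_sub]
  · exact hAy
  · simpa using hSfy.add hSy
  · exact hBz
  · simpa using hSgz.add hTz
end
end
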